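/- Let g, h : F(Σ) → F(Δ) be injective homomorphisms such that both im(g) and im(h) are inert subgroups of ⟨im(g) ∪ im(h)⟩. Then Eq(g, h) is an inert subgroup of F(Σ). -/

import Mathlib

/-- `rkLe H n` : the (free) subgroup `H` has rank at most `n`. -/
def rkLe {G : Type*} [Group G] (H : Subgroup G) (n : ℕ) : Prop :=
  ∃ S : Finset G, S.card ≤ n ∧ Subgroup.closure (S : Set G) = H

/-- `A` is inert in the subgroup `B`: `rk(A ∩ K) ≤ rk(K)` for every subgroup `K ≤ B`. -/
def InertIn {G : Type*} [Group G] (A B : Subgroup G) : Prop :=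
  ∀ K : Subgroup G, K ≤ B → ∀ n : ℕ, rkLe K n → rkLe (A ⊓ K) n

/-- A subgroup of a free group is inert (in the whole group). -/
def Inert {G : Type*} [Group G] (H : Subgroup G) : Prop :=
  ∀ K : Subgroup G, ∀ n : ℕ, rkLe K n → rkLe (H ⊓ K) n

namespace S8
open Function

section basic
variable {G : Type*} [Group G]

def dif (m : G) (u : G → ℝ) (x : G) : ℝ := u (x * m) - u x

def UU (M : Subgroup G) : Set (G → ℝ) := {u | ∀ m ∈ M, (support (dif m u)).Finite}

def Rel {ι : Type*} (y : ι → G) (M : Subgroup G) (d : ι × G → ℝ) : Prop :=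
  ∀ u ∈ UU M, ∑' p : ι × G, d p * dif (y p.1) u p.2 = 0

def FB {κ : Type*} (s : κ → G) (M : Subgroup G) : Prop :=
  ∃ b : FreeGroupBasis κ M, ∀ i, (b i : G) = s i

theorem dif_one (u : G → ℝ) (x : G) : dif 1 u x = 0 := by simp [dif]

theorem dif_mul (m n : G) (u : G → ℝ) (x : G) :
    dif (m * n) u x = dif m u x + dif n u (x * m) := by simp [dif, mul_assoc]

theorem dif_inv (m : G) (u : G → ℝ) (x : G) : dif m⁻¹ u x = - dif m u (x * m⁻¹) := by
  simp [dif]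

theorem dif_add (m : G) (u v : G → ℝ) (x : G) : dif m (u + v) x = dif m u x + dif m v x := by
  simp [dif]; ring

theorem dif_smul (m : G) (c : ℝ) (u : G → ℝ) (x : G) : dif m (c • u) x = c * dif m u x := by
  simp [dif]; ring

theorem basis_closure {κ : Type*} {M : Type*} [Group M] (b : FreeGroupBasis κ M) :
    Subgroup.closure (Set.range b) = ⊤ := by
  have h := congrArg (Subgroup.map b.repr.symm.toMonoidHom) (FreeGroup.closure_range_of κ)
  rw [MonoidHom.map_closure] at h
  have h2 : (b.repr.symm.toMonoidHom '' Set.range (FreeGroup.of : κ → _)) = Set.range b := by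
    rw [← Set.range_comp]; rfl
  rw [h2] at h
  rw [h, ← MonoidHom.range_eq_map, MonoidHom.range_eq_top]
  exact b.repr.symm.surjective

theorem FB.closure {κ : Type*} {s : κ → G} {M : Subgroup G} (h : FB s M) :
    Subgroup.closure (Set.range s) = M := by
  obtain ⟨b, hb⟩ := h
  have h := congrArg (Subgroup.map M.subtype) (basis_closure b)
  rw [MonoidHom.map_closure, ← Set.range_comp] at h
  have : (M.subtype ∘ b) = s := funext hb
  rw [this] at h
  rw [h, ← MonoidHom.range_eq_map, Subgroup.range_subtype]

theorem FB.mem {κ : Type*} {s : κ → G} {M : Subgroup G} (h : FB s M) (i : κ) : s i ∈ M := by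
  obtain ⟨b, hb⟩ := h
  rw [← hb]; exact (b i).2

theorem UU_of_gen {κ : Type*} (s : κ → G) (u : G → ℝ)
    (hu : ∀ i, (support (dif (s i) u)).Finite) : u ∈ UU (Subgroup.closure (Set.range s)) := by
  intro m hm
  induction hm using Subgroup.closure_induction with
  | mem x hx => obtain ⟨i, rfl⟩ := hx; exact hu i
  | one =>
    have : support (dif (1 : G) u) = ∅ := by ext x; simp [dif_one]
    rw [this]; exact Set.finite_empty
  | mul x y _ _ hx hy =>
    apply (hx.union (hy.preimage ((mul_left_injective x).injOn))).subset
    intro t ht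
    by_contra hc
    simp only [Set.mem_union, Set.mem_preimage, mem_support, not_or, not_not] at hc
    apply ht; rw [dif_mul, hc.1, hc.2, add_zero]
  | inv x _ hx =>
    apply (hx.preimage ((mul_left_injective x⁻¹).injOn)).subset
    intro t ht
    simp only [Set.mem_preimage, mem_support] at *
    intro hc; apply ht; rw [dif_inv, hc, neg_zero]

theorem UU_mono {N M : Subgroup G} (h : N ≤ M) : UU M ⊆ UU N := fun _ hu m hm => hu m (h hm)

theorem Rel.mono {ι : Type*} {y : ι → G} {N M : Subgroup G} (h : N ≤ M) {d : ι × G → ℝ}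
    (hd : Rel y N d) : Rel y M d := fun u hu => hd u (UU_mono h hu)

theorem local_det {κ : Type*} (s : κ → G) (m : G) (hm : m ∈ Subgroup.closure (Set.range s)) :
    ∃ Q : Finset (κ × G), ∀ (u1 u2 : G → ℝ) (x : G),
      (∀ q ∈ Q, dif (s q.1) u1 (x * q.2) = dif (s q.1) u2 (x * q.2)) →
        dif m u1 x = dif m u2 x := by
  classical
  induction hm using Subgroup.closure_induction with
  | mem t ht =>
    obtain ⟨i, rfl⟩ := ht
    exact ⟨{(i, 1)}, fun u1 u2 x h => by simpa using h (i, 1) (by simp)⟩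
  | one => exact ⟨∅, fun u1 u2 x h => by simp [dif_one]⟩
  | mul a b _ _ ha hb =>
    obtain ⟨Q1, h1⟩ := ha
    obtain ⟨Q2, h2⟩ := hb
    refine ⟨Q1 ∪ Q2.image (fun q => (q.1, a * q.2)), fun u1 u2 x h => ?_⟩
    rw [dif_mul, dif_mul, h1 u1 u2 x, h2 u1 u2 (x * a)]
    · intro q hq
      have := h (q.1, a * q.2) (by
        simp only [Finset.mem_union, Finset.mem_image]; right; exact ⟨q, hq, rfl⟩)
      simpa [mul_assoc] using this
    · intro q hq; exact h q (by simp [hq])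
  | inv a _ ha =>
    obtain ⟨Q1, h1⟩ := ha
    refine ⟨Q1.image (fun q => (q.1, a⁻¹ * q.2)), fun u1 u2 x h => ?_⟩
    rw [dif_inv, dif_inv, h1 u1 u2 (x * a⁻¹)]
    intro q hq
    have := h (q.1, a⁻¹ * q.2) (by simp only [Finset.mem_image]; exact ⟨q, hq, rfl⟩)
    simpa [mul_assoc] using this

/-- left equivariant retraction onto a subgroup -/
theorem exists_retr (N : Subgroup G) : ∃ ν : G → G, (∀ n ∈ N, ∀ x, ν (n * x) = n * ν x) ∧
    (∀ n ∈ N, ν n = n) ∧ ∀ x, ν x ∈ N := by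
  let r : G → G := fun x => (Quotient.mk (QuotientGroup.rightRel N) x).out
  have hr : ∀ x, x * (r x)⁻¹ ∈ N := by
    intro x
    have := Quotient.mk_out (s := QuotientGroup.rightRel N) x
    exact QuotientGroup.rightRel_apply.1 this
  have hr2 : ∀ n ∈ N, ∀ x, r (n * x) = r x := by
    intro n hn x
    have : (Quotient.mk (QuotientGroup.rightRel N) (n * x)) = Quotient.mk _ x := by
      apply Quotient.sound
      apply QuotientGroup.rightRel_apply.2
      simpa using hn
    simp only [r, this]
  have h1 : r 1 ∈ N := by simpa using hr 1
  refine ⟨fun x => x * (r x)⁻¹ * r 1, ?_, ?_, ?_⟩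
  · intro n hn x; simp only [hr2 n hn, mul_assoc]
  · intro n hn
    have := hr2 n hn 1
    simp only [mul_one] at this
    simp [this]
  · intro x; exact N.mul_mem (hr x) h1

theorem lemU {κ : Type*} {s : κ → G} {M : Subgroup G} (hs : FB s M) (f : κ → G → ℝ) :
    ∃ u : G → ℝ, ∀ i x, dif (s i) u x = f i x := by
  obtain ⟨b, hb⟩ := hs
  let σ : κ → Equiv.Perm (G → ℝ) := fun i =>
    { toFun := fun F x => F (x * b i) + f i x
      invFun := fun F x => F (x * (b i : G)⁻¹) - f i (x * (b i : G)⁻¹)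
      left_inv := fun F => by ext x; simp
      right_inv := fun F => by ext x; simp }
  let Ψ : M →* Equiv.Perm (G → ℝ) := b.lift σ
  have hΨ : ∀ i F x, Ψ (b i) F x = F (x * b i) + f i x := by
    intro i F x
    have : Ψ (b i) = σ i := by simp [Ψ]
    rw [this]; rfl
  have key : ∀ m : M, ∀ F x, Ψ m F x = F (x * m) + Ψ m 0 x := by
    intro m
    have hm : m ∈ Subgroup.closure (Set.range b) := by rw [basis_closure]; trivial
    induction hm using Subgroup.closure_induction with
    | mem t ht => obtain ⟨i, rfl⟩ := ht; intro F x; rw [hΨ, hΨ]; simp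
    | one => intro F x; simp
    | mul a c _ _ ha hc =>
      intro F x
      rw [map_mul, Equiv.Perm.mul_apply, Equiv.Perm.mul_apply, ha, hc, ha (Ψ c 0)]
      simp [mul_assoc]; ring
    | inv a _ ha =>
      have h3 : ∀ F x, Ψ a⁻¹ F x = F (x * (a : G)⁻¹) - Ψ a 0 (x * (a : G)⁻¹) := by
        intro F x
        have h1 := ha (Ψ a⁻¹ F) (x * (a : G)⁻¹)
        rw [← Equiv.Perm.mul_apply, ← map_mul] at h1
        simp at h1
        simp [h1]
      intro F x
      rw [h3, h3 0]; simp
      ring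
  -- coset representatives
  let t : G → G := fun x => (QuotientGroup.mk x : G ⧸ M).out
  have ht : ∀ x, (t x)⁻¹ * x ∈ M := by
    intro x
    have : (QuotientGroup.mk (t x) : G ⧸ M) = QuotientGroup.mk x := QuotientGroup.out_eq' _
    exact QuotientGroup.eq.1 this
  have ht2 : ∀ x, ∀ m ∈ M, t (x * m) = t x := by
    intro x m hm
    have : (QuotientGroup.mk (x * m) : G ⧸ M) = QuotientGroup.mk x := by
      apply QuotientGroup.eq.2; simpa using hm
    simp only [t, this]
  refine ⟨fun x => Ψ ⟨(t x)⁻¹ * x, ht x⟩ 0 (t x), fun i x => ?_⟩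
  have hc : ∀ (p : G) (hp : p ∈ M), Ψ ⟨(t x)⁻¹ * (x * s i), by
      rw [← mul_assoc]; exact M.mul_mem (ht x) (by rw [← hb]; exact (b i).2)⟩ =
      Ψ ⟨(t x)⁻¹ * x, ht x⟩ * Ψ (b i) := by
    intro p hp
    rw [← map_mul]; congr 1; ext; simp [hb, mul_assoc]
  have h5 : t (x * s i) = t x := ht2 x _ (by rw [← hb]; exact (b i).2)
  simp only [dif, h5]
  rw [hc 1 M.one_mem, Equiv.Perm.mul_apply, key _ (Ψ (b i) 0), hΨ]
  simp

theorem lemU' {κ : Type*} {s : κ → G} {M : Subgroup G} (hs : FB s M) (f : κ → G → ℝ)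
    (hf : ∀ i, (support (f i)).Finite) :
    ∃ u ∈ UU M, ∀ i x, dif (s i) u x = f i x := by
  obtain ⟨u, hu⟩ := lemU hs f
  refine ⟨u, ?_, hu⟩
  rw [← hs.closure]
  apply UU_of_gen
  intro i
  have : dif (s i) u = f i := funext (hu i)
  rw [this]; exact hf i

theorem lemExt {κ : Type*} {s : κ → G} {M N : Subgroup G} (hs : FB s M) (hNM : N ≤ M)
    {ι : Type*} [Finite ι] (y : ι → G) (hy : ∀ j, y j ∈ N) (u : G → ℝ) (hu : u ∈ UU N) :
    ∃ u' ∈ UU M, ∀ j, ∀ x ∈ N, dif (y j) u' x = dif (y j) u x := by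
  classical
  obtain ⟨ν, h1, h2, h3⟩ := exists_retr N
  have := fun j => local_det s (y j) (by rw [hs.closure]; exact hNM (hy j))
  choose Q hQ using this
  have := Fintype.ofFinite ι
  let QQ : Finset (κ × G) := Finset.univ.biUnion Q
  let f : κ → G → ℝ := fun i x =>
    if ∃ q ∈ QQ, q.1 = i ∧ ∃ n ∈ N, x = n * q.2 then dif (s i) (u ∘ ν) x else 0
  have hf : ∀ i, (support (f i)).Finite := by
    intro i
    have : support (f i) ⊆ ⋃ q ∈ QQ, (fun x => x * (ν q.2)⁻¹ * q.2) ''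
        (support (dif ((ν q.2)⁻¹ * ν (q.2 * s i)) u)) := by
      intro x hx
      rw [mem_support] at hx
      simp only [f] at hx
      split_ifs at hx with hc
      · obtain ⟨q, hq, rfl, n, hn, rfl⟩ := hc
        simp only [Set.mem_iUnion]
        refine ⟨q, hq, n * ν q.2, ?_, by simp⟩
        rw [mem_support]
        convert hx using 1
        simp only [dif, comp, h1 n hn, mul_assoc, mul_inv_cancel_left]
      · exact absurd rfl hx
    refine Set.Finite.subset (Set.Finite.biUnion QQ.finite_toSet fun q hq => Set.Finite.image _ ?_) this
    exact hu _ (N.mul_mem (N.inv_mem (h3 _)) (h3 _))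
  obtain ⟨u', hu', hd⟩ := lemU' hs f hf
  refine ⟨u', hu', fun j x hx => ?_⟩
  have : dif (y j) u x = dif (y j) (u ∘ ν) x := by
    simp only [dif, comp, h2 x hx, h2 _ (N.mul_mem hx (hy j))]
  rw [this]
  apply hQ j
  intro q hq
  rw [hd]
  simp only [f]
  rw [if_pos]
  exact ⟨q, Finset.mem_biUnion.2 ⟨j, Finset.mem_univ _, hq⟩, rfl, x, hx, rfl⟩

theorem lemL3 {κ : Type*} {s : κ → G} {M N : Subgroup G} (hs : FB s M) (hNM : N ≤ M)
    {ι : Type*} [Finite ι] (y : ι → G) (hy : ∀ j, y j ∈ N) (d : ι × G → ℝ) (hd : Rel y M d)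
    (hsupp : ∀ p, p.2 ∉ N → d p = 0) : Rel y N d := by
  intro u hu
  obtain ⟨u', hu', h⟩ := lemExt hs hNM y hy u hu
  rw [← hd u' hu']
  congr 1; ext p
  by_cases hp : p.2 ∈ N
  · rw [h _ _ hp]
  · simp [hsupp p hp]

theorem lemL3'' {κ : Type*} {s : κ → G} {M : Subgroup G} (hs : FB s M) (B : Set κ)
    {ι : Type*} (y : ι → G) (hy : ∀ j, y j ∈ Subgroup.closure (s '' B))
    (d : ι × G → ℝ) (hd : Rel y M d) : Rel y (Subgroup.closure (s '' B)) d := by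
  classical
  intro u hu
  obtain ⟨u', hu', h⟩ := lemU' hs (fun i x => if i ∈ B then dif (s i) u x else 0) (by
    intro i
    by_cases hi : i ∈ B
    · simp only [hi, if_true]
      exact hu _ (Subgroup.subset_closure ⟨i, hi, rfl⟩)
    · simp [hi, support])
  rw [← hd u' hu']
  congr 1; ext p
  congr 1
  have h1 := hy p.1
  have : s '' B = Set.range (fun i : B => s i) := by ext; simp
  rw [this] at h1
  obtain ⟨Q, hQ⟩ := local_det _ _ h1
  apply hQ
  intro q hq
  rw [h]
  simp

theorem lemL1 {κ : Type*} {s : κ → G} {M : Subgroup G} (hs : FB s M) {ι : Type*}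
    (e : ι → κ) (he : Injective e) (d : ι × G → ℝ) (hd : Rel (s ∘ e) M d) : d = 0 := by
  classical
  ext ⟨j, x⟩
  obtain ⟨u', hu', h⟩ := lemU' hs (fun i z => if i = e j ∧ z = x then 1 else 0) (by
    intro i
    apply (Set.finite_singleton x).subset
    intro z hz
    simp at hz; simp [hz.2])
  have := hd u' hu'
  rw [tsum_eq_single (j, x)] at this
  · simpa [h] using this
  · intro p hp
    simp only [comp, h]
    rw [if_neg, mul_zero]
    rintro ⟨h1, h2⟩
    exact hp (Prod.ext (he h1) h2)

/-- translate and restrict to a subgroup type -/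
theorem lemT {ι : Type*} (D N : Subgroup G) (hND : N ≤ D) (y : ι → G) (hy : ∀ j, y j ∈ N)
    (d : ι × G → ℝ) (hd : Rel y N d) (x0 : G) :
    Rel (fun j => (⟨y j, hND (hy j)⟩ : D)) (N.subgroupOf D) (fun p => d (p.1, x0 * p.2)) := by
  classical
  intro u hu
  let u' : G → ℝ := fun x => if h : x0⁻¹ * x ∈ D then u ⟨x0⁻¹ * x, h⟩ else 0
  have h0 : ∀ m (hm : m ∈ N) (x : D), dif m u' (x0 * x) = dif (⟨m, hND hm⟩ : D) u x := by
    intro m hm x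
    have h1 : x0⁻¹ * (x0 * x * m) ∈ D := by
      rw [mul_assoc, inv_mul_cancel_left]; exact D.mul_mem x.2 (hND hm)
    have h2 : x0⁻¹ * (x0 * (x : G)) ∈ D := by rw [inv_mul_cancel_left]; exact x.2
    simp only [dif, u', dif_pos h1, dif_pos h2]
    congr 2 <;> · congr 1; simp [mul_assoc]
  have h1 : ∀ m (hm : m ∈ N) (x : G), x0⁻¹ * x ∉ D → dif m u' x = 0 := by
    intro m hm x hx
    have : x0⁻¹ * (x * m) ∉ D := by
      intro h; apply hx
      have := D.mul_mem h (D.inv_mem (hND hm))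
      simpa [mul_assoc] using this
    simp [dif, u', hx, this]
  have hu' : u' ∈ UU N := by
    intro m hm
    refine Set.Finite.subset ((hu ⟨m, hND hm⟩ hm).image (fun x : D => x0 * (x : G))) ?_
    intro x hx
    by_cases hxD : x0⁻¹ * x ∈ D
    · refine ⟨⟨_, hxD⟩, ?_, by simp⟩
      rw [mem_support, ← h0 m hm]
      simpa using hx
    · exact absurd (h1 m hm x hxD) hx
  rw [← hd u' hu']
  have hinj : Injective (fun p : ι × D => ((p.1, x0 * (p.2 : G)) : ι × G)) := by
    rintro ⟨i, x⟩ ⟨j, x'⟩ h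
    simpa using h
  rw [← hinj.tsum_eq]
  · congr 1; ext p; simp only; rw [h0 _ (hy _)]
  · rintro ⟨j, x⟩ hp
    by_cases hxD : x0⁻¹ * x ∈ D
    · exact ⟨(j, ⟨_, hxD⟩), by simp⟩
    · exact absurd (by simp [h1 _ (hy j) x hxD]) hp

theorem Rel.ind {ι : Type*} {y : ι → G} {N : Subgroup G} (hy : ∀ j, y j ∈ N) {d : ι × G → ℝ}
    (hd : Rel y N d) (W : Set G) (hW : ∀ x, ∀ n ∈ N, x ∈ W → x * n ∈ W) :
    Rel y N (fun p => W.indicator 1 p.2 * d p) := by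
  classical
  have hW2 : ∀ x, ∀ n ∈ N, (x * n ∈ W ↔ x ∈ W) := by
    intro x n hn
    refine ⟨fun h => ?_, hW x n hn⟩
    simpa using hW _ _ (N.inv_mem hn) h
  intro u hu
  have h0 : ∀ m ∈ N, ∀ x, dif m (fun x => W.indicator 1 x * u x) x
      = W.indicator 1 x * dif m u x := by
    intro m hm x
    by_cases hx : x ∈ W
    · simp [dif, hx, hW2 x m hm]
    · simp [dif, hx, hW2 x m hm]
  rw [← hd (fun x => W.indicator 1 x * u x)]
  · congr 1; ext p; rw [h0 _ (hy _)]; ring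
  · intro m hm
    refine (hu m hm).subset ?_
    intro x hx hc
    apply hx; rw [h0 m hm, hc, mul_zero]

theorem Rel.trans_left {ι : Type*} {y : ι → G} {N : Subgroup G} {d : ι × G → ℝ}
    (hd : Rel y N d) (g : G) : Rel y N (fun p => d (p.1, g * p.2)) := by
  intro u hu
  have h0 : ∀ m x, dif m (fun x => u (g⁻¹ * x)) x = dif m u (g⁻¹ * x) := by
    intro m x; simp [dif, mul_assoc]
  rw [← hd (fun x => u (g⁻¹ * x))]
  · let e : ι × G ≃ ι × G := Equiv.prodCongr (Equiv.refl _) (Equiv.mulLeft g)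
    refine Eq.trans ?_ (e.tsum_eq (fun p : ι × G => d p * dif (y p.1) (fun x => u (g⁻¹ * x)) p.2))
    congr 1; ext p; simp only [h0]; simp [e, Prod.map]
  · intro m hm
    refine ((hu m hm).preimage (mul_right_injective g⁻¹).injOn).subset ?_
    intro x hx
    rw [mem_support, h0] at hx
    exact hx

end basic
end S8

namespace S8
open Function

section graph
variable {V : Type*}

def Bd (X : SimpleGraph V) (A : Set V) : Set (V × V) := {p | X.Adj p.1 p.2 ∧ p.1 ∈ A ∧ p.2 ∉ A}

def Conn (X : SimpleGraph V) (A : Set V) : Prop :=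
  ∀ B ⊆ A, (∀ x ∈ B, ∀ y ∈ A, y ∉ B → ¬ X.Adj x y) → B = ∅ ∨ B = A

def Tight (X : SimpleGraph V) (k : ℕ) (u w : V) : Set (Set V) :=
  {A | u ∈ A ∧ w ∉ A ∧ Conn X A ∧ Conn X Aᶜ ∧ (Bd X A).encard ≤ k}

theorem tight_step (X : SimpleGraph V) (k : ℕ)
    (h : ∀ u w, X.Adj u w → (Tight X k u w).Finite) (u w : V) (hr : X.Reachable u w) :
    (Tight X k u w).Finite := by
  obtain ⟨p⟩ := hr
  induction p with
  | nil =>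
    apply Set.Finite.subset Set.finite_empty
    rintro A ⟨h1, h2, _⟩
    exact absurd h1 h2
  | @cons u v w hadj p ih =>
    apply ((h u v hadj).union ih).subset
    rintro A ⟨h1, h2, h3⟩
    by_cases hv : v ∈ A
    · right; exact ⟨hv, h2, h3⟩
    · left; exact ⟨h1, hv, h3⟩

theorem tight_finite (k : ℕ) : ∀ (X : SimpleGraph V) (u w : V), X.Reachable u w →
    (Tight X k u w).Finite := by
  induction k with
  | zero =>
    intro X u w hr
    apply tight_step _ _ _ _ _ hr
    intro u w hadj
    apply Set.Finite.subset Set.finite_empty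
    rintro A ⟨h1, h2, _, _, h3⟩
    simp at h3
    have : (u, w) ∈ Bd X A := ⟨hadj, h1, h2⟩
    rw [h3] at this
    exact this
  | succ k ih =>
    intro X u w hr
    apply tight_step _ _ _ _ _ hr
    intro u w hadj
    let X' := X.deleteEdges {s(u, w)}
    have hX' : ∀ x y, X'.Adj x y ↔ X.Adj x y ∧ s(x, y) ≠ s(u, w) := by
      intro x y; simp [X', SimpleGraph.deleteEdges_adj]
    have hconn : ∀ A, (u ∉ A ∨ w ∉ A) → Conn X A → Conn X' A := by
      intro A huw hA B hB hBA
      apply hA B hB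
      intro x hx y hy hyB hxy
      apply hBA x hx y hy hyB
      rw [hX']
      refine ⟨hxy, ?_⟩
      intro he
      rw [Sym2.eq_iff] at he
      have hx' := hB hx
      rcases he with ⟨rfl, rfl⟩ | ⟨rfl, rfl⟩ <;> rcases huw with h | h <;> contradiction
    have hb : ∀ A, u ∈ A → w ∉ A → (Bd X A).encard ≤ (k + 1 : ℕ) → (Bd X' A).encard ≤ k := by
      intro A h1 h2 h3
      have hm : (u, w) ∈ Bd X A := ⟨hadj, h1, h2⟩
      have hsub : Bd X' A ⊆ Bd X A \ {(u, w)} := by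
        rintro ⟨x, y⟩ ⟨ha, hb, hc⟩
        rw [hX'] at ha
        refine ⟨⟨ha.1, hb, hc⟩, ?_⟩
        rintro h
        simp at h
        apply ha.2; simp [h.1, h.2]
      have h4 := Set.encard_sdiff_singleton_add_one hm
      have h5 := Set.encard_le_encard hsub
      rw [← h4] at h3
      push_cast at h3
      have h6 : (Bd X A \ {(u, w)}).encard ≤ k := by
        have := (ENat.add_le_add_iff_right (k := 1) (by simp)).1 h3
        exact this
      exact h5.trans h6
    by_cases hr' : X'.Reachable u w
    · apply (ih X' u w hr').subset
      rintro A ⟨h1, h2, h3, h4, h5⟩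
      exact ⟨h1, h2, hconn A (Or.inr h2) h3, hconn _ (Or.inl (by simpa using h1)) h4, hb A h1 h2 h5⟩
    · apply (Set.finite_singleton {x | X'.Reachable u x}).subset
      rintro A ⟨h1, h2, h3, h4, h5⟩
      have h3 := hconn A (Or.inr h2) h3
      have h4 := hconn _ (Or.inl (by simpa using h1)) h4
      have hcl : ∀ A v, Conn X' A → v ∈ A → A ⊆ {x | X'.Reachable v x} := by
        intro A v hA hv
        rcases hA (A ∩ {x | X'.Reachable v x}) Set.inter_subset_left (by
          rintro x ⟨hx1, hx2⟩ y hy hyn hxy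
          exact hyn ⟨hy, SimpleGraph.Reachable.trans hx2 hxy.reachable⟩) with h | h
        · have : v ∈ A ∩ {x | X'.Reachable v x} := ⟨hv, SimpleGraph.Reachable.refl _⟩
          rw [h] at this
          exact absurd this (by simp)
        · exact Set.inter_eq_left.1 h
      have h6 := hcl A u h3 h1
      have h7 := hcl Aᶜ w h4 h2
      apply Set.Subset.antisymm h6
      intro x hx
      by_contra hxA
      exact hr' (SimpleGraph.Reachable.trans hx (SimpleGraph.Reachable.symm (h7 hxA)))

theorem Bd_nonempty (X : SimpleGraph V) (hX : X.Preconnected) (B : Set V) (h1 : B.Nonempty)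
    (h2 : Bᶜ.Nonempty) : (Bd X B).Nonempty := by
  by_contra hc
  obtain ⟨x, hx⟩ := h1
  obtain ⟨y, hy⟩ := h2
  obtain ⟨p⟩ := hX x y
  have : ∀ {x y} (p : X.Walk x y), x ∈ B → y ∈ B := by
    intro x y p
    induction p with
    | nil => exact id
    | @cons u v w hadj p ih =>
      intro hu
      apply ih
      by_contra hv
      exact hc ⟨(u, v), hadj, hu, hv⟩
  exact hy (this p hx)

theorem Bd_compl (X : SimpleGraph V) (A : Set V) : (Bd X Aᶜ).encard = (Bd X A).encard := by
  have : Bd X Aᶜ = Prod.swap '' Bd X A := by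
    ext ⟨x, y⟩
    simp only [Bd, Set.mem_ofPred_eq, Set.mem_image, Prod.exists, Prod.swap_prod_mk, Prod.mk.injEq]
    constructor
    · rintro ⟨h, h1, h2⟩; exact ⟨y, x, ⟨h.symm, by simpa using h2, h1⟩, rfl, rfl⟩
    · rintro ⟨a, b, ⟨h, h1, h2⟩, rfl, rfl⟩; exact ⟨h.symm, h2, by simpa using h1⟩
  rw [this, Set.InjOn.encard_image Prod.swap_injective.injOn]

theorem encard_four {T : Type*} (P Q R S : Set T) (h1 : P ∪ Q ⊆ R ∪ S) (h2 : P ∩ Q ⊆ R ∩ S) :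
    P.encard + Q.encard ≤ R.encard + S.encard := by
  rw [← Set.encard_union_add_encard_inter P, ← Set.encard_union_add_encard_inter R]
  exact add_le_add (Set.encard_le_encard h1) (Set.encard_le_encard h2)

theorem Bd_submod (X : SimpleGraph V) (C D : Set V) :
    (Bd X (C ∩ D)).encard + (Bd X (Cᶜ ∩ Dᶜ)).encard ≤ (Bd X C).encard + (Bd X D).encard := by
  have : Cᶜ ∩ Dᶜ = (C ∪ D)ᶜ := by rw [Set.compl_union]
  rw [this, Bd_compl]
  apply encard_four
  · rintro ⟨x, y⟩
    simp only [Bd, Set.mem_union, Set.mem_inter_iff, Set.mem_ofPred_eq]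
    tauto
  · rintro ⟨x, y⟩
    simp only [Bd, Set.mem_union, Set.mem_inter_iff, Set.mem_ofPred_eq]
    tauto

def Nested (F C : Set V) : Prop := F ∩ C = ∅ ∨ F ∩ Cᶜ = ∅ ∨ Fᶜ ∩ C = ∅ ∨ Fᶜ ∩ Cᶜ = ∅

theorem nested_compl {F C : Set V} : Nested F Cᶜ ↔ Nested F C := by
  simp only [Nested, compl_compl]; tauto

theorem nested_symm {F C : Set V} (h : Nested F C) : Nested C F := by
  simp only [Nested, Set.inter_comm C, Set.inter_comm Cᶜ] at *; tauto

def Sep (A : Set V) (p : Ultrafilter V × Ultrafilter V) : Prop :=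
  (A ∈ p.1 ∧ Aᶜ ∈ p.2) ∨ (Aᶜ ∈ p.1 ∧ A ∈ p.2)

theorem sep_compl {A : Set V} {p : Ultrafilter V × Ultrafilter V} : Sep Aᶜ p ↔ Sep A p := by
  simp only [Sep, compl_compl]; tauto

theorem sep_iff {A : Set V} {p : Ultrafilter V × Ultrafilter V} :
    Sep A p ↔ (A ∈ p.1 ∧ A ∉ p.2) ∨ (A ∉ p.1 ∧ A ∈ p.2) := by
  simp only [Sep, Ultrafilter.compl_mem_iff_notMem]

theorem uf_inter {A B : Set V} {p : Ultrafilter V} : A ∩ B ∈ p ↔ A ∈ p ∧ B ∈ p :=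
  Filter.inter_mem_iff

theorem exists_min_enat {T : Type*} (f : T → ℕ∞) (S : Set T) (h : S.Nonempty) :
    ∃ B ∈ S, ∀ B' ∈ S, f B ≤ f B' := by
  obtain ⟨a, ⟨B, hB, rfl⟩, hm⟩ := (wellFounded_lt (α := ℕ∞)).has_min (f '' S) (h.image f)
  exact ⟨B, hB, fun B' hB' => not_lt.1 (hm _ ⟨B', hB', rfl⟩)⟩

variable (X : SimpleGraph V) (κ : ℕ)

def MinC (p : Ultrafilter V × Ultrafilter V) (A : Set V) : Prop :=
  Sep A p ∧ (Bd X A).encard ≤ κ ∧ ∀ B, Sep B p → (Bd X A).encard ≤ (Bd X B).encard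

def CM : Set (Set V) := {A | ∃ p, MinC X κ p A}

def Cr (A : Set V) : Set (Set V) := {F ∈ CM X κ | ¬ Nested F A}

def Opt (p : Ultrafilter V × Ultrafilter V) (A : Set V) : Prop :=
  MinC X κ p A ∧ ∀ B, MinC X κ p B → (Cr X κ A).encard ≤ (Cr X κ B).encard

variable {X κ}

theorem MinC.compl {p : Ultrafilter V × Ultrafilter V} {A : Set V} (h : MinC X κ p A) :
    MinC X κ p Aᶜ := by
  refine ⟨sep_compl.2 h.1, ?_, ?_⟩ <;> rw [Bd_compl]
  exacts [h.2.1, h.2.2]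

theorem Cr_compl {A : Set V} : Cr X κ Aᶜ = Cr X κ A := by
  ext F; simp [Cr, nested_compl]

theorem Opt.compl {p : Ultrafilter V × Ultrafilter V} {A : Set V} (h : Opt X κ p A) :
    Opt X κ p Aᶜ := by
  refine ⟨h.1.compl, ?_⟩
  rw [Cr_compl]; exact h.2

theorem MinC.conn (hX : X.Preconnected) {p : Ultrafilter V × Ultrafilter V} {A : Set V}
    (h : MinC X κ p A) : Conn X A := by
  intro B hB hBA
  by_contra! hc
  obtain ⟨hB0, hBA'⟩ := hc
  obtain ⟨hs, hk, hmin⟩ := h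
  have hAc : (Aᶜ).Nonempty := by
    rcases hs with h | h
    · exact Ultrafilter.nonempty_of_mem h.2
    · exact Ultrafilter.nonempty_of_mem h.1
  have hne1 : (Bd X B).Nonempty := Bd_nonempty X hX B (by simpa using hB0) (hAc.mono (Set.compl_subset_compl.2 hB))
  have hne2 : (Bd X (A \ B)).Nonempty := Bd_nonempty X hX _ (by
    by_contra h; rw [Set.not_nonempty_iff_eq_empty, Set.sdiff_eq_empty] at h
    exact hBA' (Set.Subset.antisymm hB h)) (hAc.mono (Set.compl_subset_compl.2 Set.sdiff_subset))
  have hsum : (Bd X B).encard + (Bd X (A \ B)).encard ≤ (Bd X A).encard := by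
    rw [← Set.encard_union_eq]
    · apply Set.encard_le_encard
      rintro ⟨x, y⟩ (⟨h1, h2, h3⟩ | ⟨h1, h2, h3⟩)
      · exact ⟨h1, hB h2, fun hy => hBA x h2 y hy h3 h1⟩
      · refine ⟨h1, h2.1, fun hy => ?_⟩
        have hyB : y ∈ B := by by_contra h; exact h3 ⟨hy, h⟩
        exact hBA y hyB x h2.1 h2.2 h1.symm
    · rw [Set.disjoint_left]
      rintro ⟨x, y⟩ ⟨_, h2, _⟩ ⟨_, h3, _⟩
      exact h3.2 h2
  have hsep : Sep B p ∨ Sep (A \ B) p := by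
    have hU : A = B ∪ (A \ B) := by simp [Set.union_eq_right.2 hB]
    have e1 : ∀ q : Ultrafilter V, Aᶜ ∈ q → Bᶜ ∈ q ∧ (A \ B)ᶜ ∈ q := fun q hq =>
      ⟨Filter.mem_of_superset hq (Set.compl_subset_compl.2 hB),
       Filter.mem_of_superset hq (Set.compl_subset_compl.2 Set.sdiff_subset)⟩
    have e2 : ∀ q : Ultrafilter V, A ∈ q → B ∈ q ∨ (A \ B) ∈ q := fun q hq => by
      rw [hU] at hq; exact Ultrafilter.union_mem_iff.1 hq
    rcases hs with ⟨h1, h2⟩ | ⟨h1, h2⟩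
    · have := e1 _ h2
      rcases e2 _ h1 with h | h
      · left; left; exact ⟨h, this.1⟩
      · right; left; exact ⟨h, this.2⟩
    · have := e1 _ h1
      rcases e2 _ h2 with h | h
      · left; right; exact ⟨this.1, h⟩
      · right; right; exact ⟨this.2, h⟩
  rw [← Set.one_le_encard_iff_nonempty] at hne1 hne2
  have hfin : (Bd X A).encard ≠ ⊤ := ne_top_of_le_ne_top (by simp) hk
  have h1f : (Bd X B).encard ≠ ⊤ := ne_top_of_le_ne_top hfin (le_self_add.trans hsum)
  have h2f : (Bd X (A \ B)).encard ≠ ⊤ := ne_top_of_le_ne_top hfin (le_add_self.trans hsum)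
  have hmm : (Bd X A).encard ≤ (Bd X B).encard ∨ (Bd X A).encard ≤ (Bd X (A \ B)).encard :=
    hsep.imp (hmin _) (hmin _)
  clear hmin hk
  generalize (Bd X A).encard = a at *
  generalize (Bd X B).encard = b at *
  generalize (Bd X (A \ B)).encard = c at *
  lift a to ℕ using hfin
  lift b to ℕ using h1f
  lift c to ℕ using h2f
  norm_cast at *
  omega

theorem Cr_finite (hX : X.Preconnected) {A : Set V} (hA : (Bd X A).Finite) :
    (Cr X κ A).Finite := by
  let W : Set V := Prod.fst '' Bd X A ∪ Prod.snd '' Bd X A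
  have hW : W.Finite := (hA.image _).union (hA.image _)
  have hsub : Cr X κ A ⊆ ⋃ p ∈ W ×ˢ W, Tight X κ p.1 p.2 := by
    rintro F ⟨⟨p, hF⟩, hn⟩
    have hc1 := hF.conn hX
    have hc2 := hF.compl.conn hX
    have key : ∀ D : Set V, Conn X D → (∀ x ∈ W, x ∉ D) → Nested D A := by
      intro D hD hDW
      rcases hD (D ∩ A) Set.inter_subset_left (by
        rintro x ⟨hx, hxA⟩ y hy hyn hxy
        have : (x, y) ∈ Bd X A := ⟨hxy, hxA, fun h => hyn ⟨hy, h⟩⟩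
        exact hDW x (Or.inl ⟨_, this, rfl⟩) hx) with h | h
      · exact Or.inl h
      · right; left
        rw [← h]; ext x; simp
    have h1 : ∃ x ∈ W, x ∈ F := by
      by_contra! h
      exact hn (key F hc1 h)
    have h2 : ∃ y ∈ W, y ∉ F := by
      by_contra! h
      have := key Fᶜ hc2 (by simpa using h)
      exact hn (nested_symm (nested_compl.1 (nested_symm this)))
    obtain ⟨x, hx, hxF⟩ := h1
    obtain ⟨y, hy, hyF⟩ := h2
    simp only [Set.mem_iUnion]
    exact ⟨(x, y), ⟨hx, hy⟩, hxF, hyF, hc1, hc2, hF.2.1⟩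
  refine Set.Finite.subset (Set.Finite.biUnion (hW.prod hW) ?_) hsub
  rintro ⟨x, y⟩ _
  exact tight_finite κ X x y (hX x y)

theorem opt_nested1 (hX : X.Preconnected) {p q : Ultrafilter V × Ultrafilter V} {C D : Set V}
    (hC : Opt X κ p C) (hD : Opt X κ q D) (h1 : Sep (C ∩ D) p) (h2 : Sep (Cᶜ ∩ Dᶜ) q) :
    Nested C D := by
  by_contra hn
  have hb := Bd_submod X C D
  have b1 := hC.1.2.2 _ h1
  have b2 := hD.1.2.2 _ h2
  have f1 : (Bd X C).encard ≠ ⊤ := ne_top_of_le_ne_top (by simp) hC.1.2.1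
  have f2 : (Bd X D).encard ≠ ⊤ := ne_top_of_le_ne_top (by simp) hD.1.2.1
  have heq : (Bd X (C ∩ D)).encard = (Bd X C).encard ∧
      (Bd X (Cᶜ ∩ Dᶜ)).encard = (Bd X D).encard := by
    have f3 : (Bd X (C ∩ D)).encard ≠ ⊤ := ne_top_of_le_ne_top (by simp [f1, f2]) (le_self_add.trans hb)
    have f4 : (Bd X (Cᶜ ∩ Dᶜ)).encard ≠ ⊤ := ne_top_of_le_ne_top (by simp [f1, f2]) (le_add_self.trans hb)
    generalize (Bd X C).encard = a at *
    generalize (Bd X D).encard = b at *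
    generalize (Bd X (C ∩ D)).encard = c at *
    generalize (Bd X (Cᶜ ∩ Dᶜ)).encard = d at *
    lift a to ℕ using f1
    lift b to ℕ using f2
    lift c to ℕ using f3
    lift d to ℕ using f4
    norm_cast at *
    omega
  have m1 : MinC X κ p (C ∩ D) :=
    ⟨h1, by rw [heq.1]; exact hC.1.2.1, by rw [heq.1]; exact hC.1.2.2⟩
  have m2 : MinC X κ q (Cᶜ ∩ Dᶜ) :=
    ⟨h2, by rw [heq.2]; exact hD.1.2.1, by rw [heq.2]; exact hD.1.2.2⟩
  have c1 := hC.2 _ m1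
  have c2 := hD.2 _ m2
  have fin : ∀ {r A}, MinC X κ r A → (Cr X κ A).Finite := fun h => Cr_finite hX (by
    rw [← Set.encard_ne_top_iff]; exact ne_top_of_le_ne_top (by simp) h.2.1)
  have g1 := fin hC.1
  have g2 := fin hD.1
  have hU : Cr X κ (C ∩ D) ∪ Cr X κ (Cᶜ ∩ Dᶜ) ⊆ (Cr X κ C ∪ Cr X κ D) \ {C} := by
    have sub1 : ∀ C D F : Set V, ¬ Nested C D → Nested F C → Nested F D → Nested F (C ∩ D) := by
      intro C D F hn hFC hFD
      simp only [Nested, Set.eq_empty_iff_forall_notMem, Set.mem_inter_iff, Set.mem_compl_iff] at *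
      rcases hFC with h | h | h | h
      · left; intro x; have := h x; tauto
      · rcases hFD with h' | h' | h' | h'
        · left; intro x; have := h' x; tauto
        · right; left; intro x; have := h x; have := h' x; tauto
        · right; right; left; intro x; have := h' x; tauto
        · exfalso; apply hn; right; right; right; intro x; have := h x; have := h' x; tauto
      · right; right; left; intro x; have := h x; tauto
      · rcases hFD with h' | h' | h' | h'
        · left; intro x; have := h' x; tauto
        · exfalso; apply hn; right; right; right; intro x; have := h x; have := h' x; tauto
        · right; right; left; intro x; have := h' x; tauto
        · right; right; right; intro x; have := h x; have := h' x; tauto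
    have hn' : ¬ Nested Cᶜ Dᶜ := fun h => hn (nested_symm (nested_compl.1 (nested_symm (nested_compl.1 h))))
    have self1 : Nested C (C ∩ D) := by right; right; left; ext x; simp; tauto
    have self2 : Nested C (Cᶜ ∩ Dᶜ) := by left; ext x; simp; tauto
    rintro F (⟨hF, hFn⟩ | ⟨hF, hFn⟩)
    · refine ⟨?_, ?_⟩
      · by_contra h
        simp only [Set.mem_union, Cr, Set.mem_ofPred_eq, hF, true_and, not_or, not_not] at h
        exact hFn (sub1 C D F hn h.1 h.2)
      · rintro rfl; exact hFn self1
    · refine ⟨?_, ?_⟩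
      · by_contra h
        simp only [Set.mem_union, Cr, Set.mem_ofPred_eq, hF, true_and, not_or, not_not] at h
        exact hFn (sub1 Cᶜ Dᶜ F hn' (nested_compl.2 h.1) (nested_compl.2 h.2))
      · rintro rfl; exact hFn self2
  have hI : Cr X κ (C ∩ D) ∩ Cr X κ (Cᶜ ∩ Dᶜ) ⊆ Cr X κ C ∩ Cr X κ D := by
    have sub2 : ∀ C D F : Set V, Nested F C → Nested F (C ∩ D) ∨ Nested F (Cᶜ ∩ Dᶜ) := by
      intro C D F h
      simp only [Nested, Set.eq_empty_iff_forall_notMem, Set.mem_inter_iff, Set.mem_compl_iff] at *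
      rcases h with h | h | h | h
      · left; left; intro x; have := h x; tauto
      · right; left; intro x; have := h x; tauto
      · left; right; right; left; intro x; have := h x; tauto
      · right; right; right; left; intro x; have := h x; tauto
    rintro F ⟨⟨hF, h1⟩, ⟨_, h2⟩⟩
    refine ⟨⟨hF, fun h => ?_⟩, ⟨hF, fun h => ?_⟩⟩
    · rcases sub2 C D F h with h | h <;> contradiction
    · have := sub2 D C F h
      rw [Set.inter_comm D C, Set.inter_comm Dᶜ] at this
      rcases this with h | h <;> contradiction
  have hCm : C ∈ Cr X κ C ∪ Cr X κ D := Or.inr ⟨⟨p, hC.1⟩, hn⟩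
  have e1 := Set.encard_union_add_encard_inter (Cr X κ (C ∩ D)) (Cr X κ (Cᶜ ∩ Dᶜ))
  have e2 := Set.encard_union_add_encard_inter (Cr X κ C) (Cr X κ D)
  have e3 := Set.encard_sdiff_singleton_add_one hCm
  have e4 := Set.encard_le_encard hU
  have e5 := Set.encard_le_encard hI
  have k1 : (Cr X κ C).encard ≠ ⊤ := Set.encard_ne_top_iff.2 g1
  have k2 : (Cr X κ D).encard ≠ ⊤ := Set.encard_ne_top_iff.2 g2
  have k3 : (Cr X κ (C ∩ D)).encard ≠ ⊤ := Set.encard_ne_top_iff.2 (fin m1)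
  have k4 : (Cr X κ (Cᶜ ∩ Dᶜ)).encard ≠ ⊤ := Set.encard_ne_top_iff.2 (fin m2)
  have k5 : (Cr X κ C ∪ Cr X κ D).encard ≠ ⊤ := Set.encard_ne_top_iff.2 (g1.union g2)
  have k6 : (Cr X κ C ∩ Cr X κ D).encard ≠ ⊤ := Set.encard_ne_top_iff.2 (g1.subset Set.inter_subset_left)
  have k7 : ((Cr X κ C ∪ Cr X κ D) \ {C}).encard ≠ ⊤ := Set.encard_ne_top_iff.2 ((g1.union g2).subset Set.sdiff_subset)
  have k8 : (Cr X κ (C ∩ D) ∪ Cr X κ (Cᶜ ∩ Dᶜ)).encard ≠ ⊤ := ne_top_of_le_ne_top k7 e4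
  have k9 : (Cr X κ (C ∩ D) ∩ Cr X κ (Cᶜ ∩ Dᶜ)).encard ≠ ⊤ := ne_top_of_le_ne_top k6 e5
  clear hU hI hCm heq hb b1 b2 f1 f2 fin g1 g2
  generalize (Cr X κ (C ∩ D) ∪ Cr X κ (Cᶜ ∩ Dᶜ)).encard = a1 at *
  generalize (Cr X κ (C ∩ D) ∩ Cr X κ (Cᶜ ∩ Dᶜ)).encard = a2 at *
  generalize ((Cr X κ C ∪ Cr X κ D) \ {C}).encard = a3 at *
  generalize (Cr X κ C ∪ Cr X κ D).encard = a4 at *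
  generalize (Cr X κ C ∩ Cr X κ D).encard = a5 at *
  generalize (Cr X κ (C ∩ D)).encard = a6 at *
  generalize (Cr X κ (Cᶜ ∩ Dᶜ)).encard = a7 at *
  generalize (Cr X κ C).encard = a8 at *
  generalize (Cr X κ D).encard = a9 at *
  lift a1 to ℕ using k8
  lift a2 to ℕ using k9
  lift a3 to ℕ using k7
  lift a4 to ℕ using k5
  lift a5 to ℕ using k6
  lift a6 to ℕ using k3
  lift a7 to ℕ using k4
  lift a8 to ℕ using k1
  lift a9 to ℕ using k2
  norm_cast at *
  omega

theorem opt_nested (hX : X.Preconnected) {p q : Ultrafilter V × Ultrafilter V} {C D : Set V}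
    (hC : Opt X κ p C) (hD : Opt X κ q D) : Nested C D := by
  have ncc : ∀ {C D : Set V}, Nested Cᶜ D → Nested C D := fun h =>
    nested_symm (nested_compl.1 (nested_symm h))
  -- general corner lemma
  have gen : ∀ r s, Opt X κ r C → Opt X κ s D →
      ((Sep (C ∩ D) r ∧ Sep (Cᶜ ∩ Dᶜ) s) ∨ (Sep (Cᶜ ∩ Dᶜ) r ∧ Sep (C ∩ D) s) ∨
       (Sep (C ∩ Dᶜ) r ∧ Sep (Cᶜ ∩ D) s) ∨ (Sep (Cᶜ ∩ D) r ∧ Sep (C ∩ Dᶜ) s)) → Nested C D := by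
    intro r s hC hD h
    rcases h with ⟨h1, h2⟩ | ⟨h1, h2⟩ | ⟨h1, h2⟩ | ⟨h1, h2⟩
    · exact opt_nested1 hX hC hD h1 h2
    · exact ncc (nested_compl.1 (opt_nested1 hX hC.compl hD.compl h1 (by simpa using h2)))
    · exact nested_compl.1 (opt_nested1 hX hC hD.compl h1 (by simpa using h2))
    · exact ncc (opt_nested1 hX hC.compl hD h1 (by simpa using h2))
  have hsp := hC.1.1
  have hsq := hD.1.1
  have bad : Sep D p → Sep C q → Opt X κ p D := by
    intro h1 h2
    have hb1 := hC.1.2.2 _ h1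
    have hb2 := hD.1.2.2 _ h2
    have hbe := le_antisymm hb1 hb2
    have mD : MinC X κ p D := ⟨h1, hD.1.2.1, by rw [← hbe]; exact hC.1.2.2⟩
    have mC : MinC X κ q C := ⟨h2, hC.1.2.1, by rw [hbe]; exact hD.1.2.2⟩
    have hm1 := hC.2 _ mD
    have hm2 := hD.2 _ mC
    exact ⟨mD, by rw [← le_antisymm hm1 hm2]; exact hC.2⟩
  have hbad2 : Sep D p → Sep C q → Nested C D := by
    intro h1 h2
    refine gen p p hC (bad h1 h2) ?_
    have hsp' := hsp
    simp only [sep_iff, uf_inter, Ultrafilter.compl_mem_iff_notMem] at h1 h2 hsp' ⊢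
    clear * - h1 h2 hsp'
    generalize (C ∈ p.1) = c1 at *
    generalize (C ∈ p.2) = c2 at *
    generalize (D ∈ p.1) = d1 at *
    generalize (D ∈ p.2) = d2 at *
    by_cases c1 <;> by_cases c2 <;> by_cases d1 <;> by_cases d2 <;> simp_all
  by_contra hn
  have h1 := fun h => hn (gen p q hC hD h)
  have h2 := fun h h' => hn (hbad2 h h')
  simp only [sep_iff, uf_inter, Ultrafilter.compl_mem_iff_notMem] at h1 h2 hsp hsq
  clear * - h1 h2 hsp hsq
  generalize (C ∈ p.1) = c1 at *
  generalize (C ∈ p.2) = c2 at *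
  generalize (D ∈ p.1) = d1 at *
  generalize (D ∈ p.2) = d2 at *
  generalize (C ∈ q.1) = c3 at *
  generalize (C ∈ q.2) = c4 at *
  generalize (D ∈ q.1) = d3 at *
  generalize (D ∈ q.2) = d4 at *
  by_cases c1 <;> by_cases c2 <;> by_cases d3 <;> by_cases d4 <;> simp_all <;>
    by_cases d1 <;> by_cases d2 <;> by_cases c3 <;> by_cases c4 <;> simp_all

theorem nest_main (X : SimpleGraph V) (hX : X.Preconnected) (κ : ℕ) : ∃ E : Set (Set V),
    (∀ A ∈ E, Aᶜ ∈ E) ∧ (∀ A ∈ E, ∀ B ∈ E, Nested A B) ∧ (∀ A ∈ E, (Bd X A).Finite) ∧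
    (∀ x y, {A ∈ E | x ∈ A ∧ y ∉ A}.Finite) ∧
    (∀ ψ : V ≃ V, (∀ x y, X.Adj (ψ x) (ψ y) ↔ X.Adj x y) → ∀ A ∈ E, ψ '' A ∈ E) ∧
    (∀ U W : Ultrafilter V, (∃ A, A ∈ U ∧ Aᶜ ∈ W ∧ (Bd X A).encard ≤ κ) →
      ∃ A ∈ E, A ∈ U ∧ Aᶜ ∈ W) := by
  refine ⟨{A | ∃ p, Opt X κ p A}, ?_, ?_, ?_, ?_, ?_, ?_⟩
  · rintro A ⟨p, h⟩; exact ⟨p, h.compl⟩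
  · rintro A ⟨p, h⟩ B ⟨q, h'⟩; exact opt_nested hX h h'
  · rintro A ⟨p, h⟩
    rw [← Set.encard_ne_top_iff]; exact ne_top_of_le_ne_top (by simp) h.1.2.1
  · intro x y
    apply (tight_finite κ X x y (hX x y)).subset
    rintro A ⟨⟨p, h⟩, h1, h2⟩
    exact ⟨h1, h2, h.1.conn hX, h.1.compl.conn hX, h.1.2.1⟩
  · intro ψ hψ A hA
    have bd : ∀ (ψ : V ≃ V), (∀ x y, X.Adj (ψ x) (ψ y) ↔ X.Adj x y) →
        ∀ A, (Bd X (ψ '' A)).encard = (Bd X A).encard := by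
      intro ψ hψ A
      have : Bd X (ψ '' A) = (Prod.map ψ ψ) '' Bd X A := by
        ext ⟨x, y⟩
        simp only [Bd, Set.mem_ofPred_eq, Set.mem_image, Prod.exists, Prod.map_apply, Prod.mk.injEq]
        constructor
        · rintro ⟨h, ⟨a, ha, rfl⟩, h2⟩
          refine ⟨a, ψ.symm y, ⟨?_, ha, fun hy => h2 ⟨_, hy, by simp⟩⟩, rfl, by simp⟩
          rw [← hψ]; simpa using h
        · rintro ⟨a, b, ⟨h1, h2, h3⟩, rfl, rfl⟩
          refine ⟨(hψ _ _).2 h1, ⟨a, h2, rfl⟩, ?_⟩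
          rintro ⟨c, hc, he⟩
          exact h3 (ψ.injective he ▸ hc)
      rw [this, Set.InjOn.encard_image (Function.Injective.prodMap ψ.injective ψ.injective).injOn]
    let mp : (V ≃ V) → Ultrafilter V × Ultrafilter V → Ultrafilter V × Ultrafilter V :=
      fun ψ p => (p.1.map ψ, p.2.map ψ)
    have sp : ∀ (ψ : V ≃ V) A p, Sep (ψ '' A) (mp ψ p) ↔ Sep A p := by
      intro ψ A p
      simp [Sep, mp, Set.preimage_image_eq _ ψ.injective, ← Set.image_compl_eq ψ.bijective]
    have mc : ∀ (ψ : V ≃ V), (∀ x y, X.Adj (ψ x) (ψ y) ↔ X.Adj x y) →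
        ∀ A p, MinC X κ p A → MinC X κ (mp ψ p) (ψ '' A) := by
      intro ψ hψ A p ⟨h1, h2, h3⟩
      refine ⟨(sp ψ A p).2 h1, by rw [bd ψ hψ]; exact h2, fun B hB => ?_⟩
      have : B = ψ '' (ψ.symm '' B) := by simp [← Set.image_comp]
      rw [this] at hB ⊢
      rw [sp] at hB
      rw [bd ψ hψ, bd ψ hψ]; exact h3 _ hB
    have hψ' : ∀ x y, X.Adj (ψ.symm x) (ψ.symm y) ↔ X.Adj x y := by
      intro x y; rw [← hψ]; simp
    have mpi : ∀ p, mp ψ.symm (mp ψ p) = p := by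
      intro p; ext <;> simp [mp]
    have mpi' : ∀ p, mp ψ (mp ψ.symm p) = p := by
      intro p; ext <;> simp [mp]
    have imi : ∀ B : Set V, ψ.symm '' (ψ '' B) = B := by intro B; simp [← Set.image_comp]
    have imi' : ∀ B : Set V, ψ '' (ψ.symm '' B) = B := by intro B; simp [← Set.image_comp]
    have nst : ∀ F C : Set V, Nested (ψ '' F) (ψ '' C) ↔ Nested F C := by
      intro F C
      simp [Nested, ← Set.image_compl_eq ψ.bijective, ← Set.image_inter ψ.injective]
    have cr : ∀ A, Cr X κ (ψ '' A) = (fun F => ψ '' F) '' Cr X κ A := by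
      intro A
      ext F
      simp only [Cr, CM, Set.mem_ofPred_eq, Set.mem_image]
      constructor
      · rintro ⟨⟨p, hp⟩, hn⟩
        refine ⟨ψ.symm '' F, ⟨⟨_, mc _ hψ' _ _ hp⟩, ?_⟩, imi' F⟩
        rw [← nst, imi']; exact hn
      · rintro ⟨F, ⟨⟨p, hp⟩, hn⟩, rfl⟩
        exact ⟨⟨_, mc _ hψ _ _ hp⟩, by rwa [nst]⟩
    have cre : ∀ A, (Cr X κ (ψ '' A)).encard = (Cr X κ A).encard := by
      intro A
      rw [cr, Set.InjOn.encard_image (Set.image_injective.2 ψ.injective).injOn]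
    obtain ⟨p, h1, h2⟩ := hA
    refine ⟨mp ψ p, mc ψ hψ A p h1, fun B hB => ?_⟩
    have := mc _ hψ' _ _ hB
    rw [mpi] at this
    rw [cre, ← imi' B, cre]
    exact h2 _ this
  · rintro U W ⟨A, hU, hW, hk⟩
    let S1 := {B : Set V | Sep B (U, W)}
    have hA1 : A ∈ S1 := Or.inl ⟨hU, hW⟩
    obtain ⟨B, hB, hBm⟩ := exists_min_enat (fun B : Set V => (Bd X B).encard) S1 ⟨A, hA1⟩
    have hBM : MinC X κ (U, W) B := ⟨hB, (hBm A hA1).trans hk, hBm⟩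
    obtain ⟨C, hC, hCm⟩ := exists_min_enat (fun B : Set V => (Cr X κ B).encard)
      {B | MinC X κ (U, W) B} ⟨B, hBM⟩
    have hCO : Opt X κ (U, W) C := ⟨hC, hCm⟩
    rcases hC.1 with h | h
    · exact ⟨C, ⟨_, hCO⟩, h⟩
    · exact ⟨Cᶜ, ⟨_, hCO.compl⟩, h.1, by simpa using h.2⟩
end graph
end S8

namespace S8
open Function

section cuts
variable {G : Type*} [Group G]

theorem pow_inj_of_ne_one [IsMulTorsionFree G] {g : G} (hg : g ≠ 1) :
    Injective (fun n : ℕ => g ^ n) := by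
  exact injective_pow_iff_not_isOfFinOrder.2 (not_isOfFinOrder_of_isMulTorsionFree hg)

theorem ev_const [IsMulTorsionFree G] {g : G} (hg : g ≠ 1) (v : G → ℝ)
    (hv : (support (dif g v)).Finite) : ∃ L : ℝ, ∃ N : ℕ, ∀ n ≥ N, v (g ^ n) = L := by
  have h1 := hv.preimage (pow_inj_of_ne_one hg).injOn
  obtain ⟨N, hN⟩ := h1.bddAbove
  refine ⟨v (g ^ (N + 1)), N + 1, fun n hn => ?_⟩
  induction n, hn using Nat.le_induction with
  | base => rfl
  | succ n hn ih =>
    have : n ∉ (fun n : ℕ => g ^ n) ⁻¹' support (dif g v) := fun h => by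
      have := hN h; omega
    simp only [Set.mem_preimage, mem_support, not_not, dif] at this
    rw [pow_succ, ← ih]; linarith

theorem sep_ends {κ : Type*} [Finite κ] {s : κ → G} (hs : FB s (⊤ : Subgroup G))
    [IsMulTorsionFree G] (uk : κ → G → ℝ) (huk : ∀ k, uk k ∈ UU (⊤ : Subgroup G))
    (hd : ∀ k, ∀ i x, dif (s i) (uk k) x = (open Classical in if i = k ∧ x = 1 then 1 else 0))
    (g : G) (hg : g ≠ 1) : ∃ k z, ∃ L1 L2 : ℝ, L1 ≠ L2 ∧ ∃ N : ℕ, ∀ n ≥ N,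
      uk k (z * g ^ n) = L1 ∧ uk k (z * (g⁻¹) ^ n) = L2 := by
  classical
  have := Fintype.ofFinite κ
  by_contra hcon
  push Not at hcon
  have hev : ∀ k z, ∃ L : ℝ, ∃ N : ℕ, ∀ n ≥ N, uk k (z * g ^ n) = L ∧ uk k (z * g⁻¹ ^ n) = L := by
    intro k z
    have hf : ∀ m, (support (dif m (fun x => uk k (z * x)))).Finite := by
      intro m
      have := (huk k m trivial).preimage (mul_right_injective z).injOn
      apply this.subset
      intro x hx
      simpa [dif, mul_assoc] using hx
    obtain ⟨L1, N1, h1⟩ := ev_const hg _ (hf g)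
    obtain ⟨L2, N2, h2⟩ := ev_const (inv_ne_one.2 hg) _ (hf g⁻¹)
    by_cases hL : L1 = L2
    · subst hL
      exact ⟨L1, max N1 N2, fun n hn => ⟨h1 n (le_trans (le_max_left _ _) hn),
        h2 n (le_trans (le_max_right _ _) hn)⟩⟩
    · obtain ⟨n, hn, h⟩ := hcon k z L1 L2 hL (max N1 N2)
      exact absurd (h2 n (le_trans (le_max_right _ _) hn)) (h (h1 n (le_trans (le_max_left _ _) hn)))
  choose L N hLN using hev
  -- the test function on powers of g
  let u0 : G → ℝ := fun x => if ∃ n : ℕ, x = g ^ n then 1 else 0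
  have hu0 : ∀ x, x ≠ g⁻¹ → dif g u0 x = 0 := by
    intro x hx
    have : (∃ n : ℕ, x * g = g ^ n) ↔ (∃ n : ℕ, x = g ^ n) := by
      constructor
      · rintro ⟨n, hn⟩
        cases n with
        | zero => exact absurd (eq_inv_of_mul_eq_one_left (by simpa using hn)) hx
        | succ n => exact ⟨n, by rw [pow_succ] at hn; exact mul_right_cancel hn⟩
      · rintro ⟨n, rfl⟩; exact ⟨n + 1, by rw [pow_succ]⟩
    simp [dif, u0, this]
  have hu1 : dif g u0 g⁻¹ = 1 := by
    have h1 : ∃ n : ℕ, g⁻¹ * g = g ^ n := ⟨0, by simp⟩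
    have h2 : ¬ ∃ n : ℕ, g⁻¹ = g ^ n := by
      rintro ⟨n, hn⟩
      have : g ^ (n + 1) = g ^ 0 := by rw [pow_succ, ← hn]; simp
      have := pow_inj_of_ne_one hg this
      omega
    simp only [dif, u0, if_pos h1, if_neg h2]; norm_num
  have hu0U : u0 ∈ UU (Subgroup.closure (Set.range (fun _ : Unit => g))) := by
    apply UU_of_gen
    intro _
    apply (Set.finite_singleton g⁻¹).subset
    intro x hx
    by_contra h
    exact hx (hu0 x h)
  have hgm : g ∈ Subgroup.closure (Set.range (fun _ : Unit => g)) :=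
    Subgroup.subset_closure ⟨(), rfl⟩
  obtain ⟨u', hu', hd'⟩ := lemExt hs le_top (fun _ : Unit => g) (fun _ => hgm) u0 hu0U
  have hd' := hd' ()
  have hp : ∀ n : ℕ, u' (g ^ n) = u' 1 := by
    intro n
    induction n with
    | zero => simp
    | succ n ih =>
      have h1 := hd' (g ^ n) (Subgroup.pow_mem _ hgm n)
      rw [hu0] at h1
      · simp only [dif] at h1; rw [pow_succ, ← ih]; linarith
      · intro h
        have : g ^ (n + 1) = g ^ 0 := by rw [pow_succ, h]; simp
        have := pow_inj_of_ne_one hg this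
        omega
  have hm : ∀ n : ℕ, u' (g⁻¹ ^ (n + 1)) = u' 1 - 1 := by
    intro n
    induction n with
    | zero =>
      have h1 := hd' g⁻¹ (Subgroup.inv_mem _ hgm)
      rw [hu1] at h1
      simp [dif] at h1; simp; linarith
    | succ n ih =>
      have h1 := hd' (g⁻¹ ^ (n + 2)) (Subgroup.pow_mem _ (Subgroup.inv_mem _ hgm) _)
      rw [hu0] at h1
      · simp only [dif] at h1
        have : g⁻¹ ^ (n + 2) * g = g⁻¹ ^ (n + 1) := by rw [pow_succ]; simp
        rw [this, ih] at h1; linarith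
      · intro h
        have : g⁻¹ ^ (n + 2) = g⁻¹ ^ 1 := by rw [h]; simp
        have := pow_inj_of_ne_one (inv_ne_one.2 hg) this
        omega
  -- decomposition
  have hfin : ∀ k, (support (dif (s k) u')).Finite := fun k => hu' _ trivial
  let u2 : G → ℝ := fun x => ∑ k, ∑ z ∈ (hfin k).toFinset, dif (s k) u' z * uk k (z⁻¹ * x)
  have hu2 : ∀ i x, dif (s i) u2 x = dif (s i) u' x := by
    intro i x
    have : dif (s i) u2 x = ∑ k, ∑ z ∈ (hfin k).toFinset, dif (s k) u' z *
        dif (s i) (uk k) (z⁻¹ * x) := by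
      simp only [u2, dif, ← Finset.sum_sub_distrib, ← mul_sub, mul_assoc]
    rw [this]
    simp only [hd]
    rw [Finset.sum_eq_single i]
    · by_cases hx : x ∈ (hfin i).toFinset
      · rw [Finset.sum_eq_single x]
        · simp
        · intro z _ hz
          rw [if_neg, mul_zero]
          rintro ⟨_, h⟩
          exact hz (inv_mul_eq_one.1 h)
        · exact fun h => absurd hx h
      · rw [Finset.sum_eq_zero]
        · simp at hx; exact hx.symm
        · intro z hz
          rw [if_neg, mul_zero]
          rintro ⟨_, h⟩
          rw [inv_mul_eq_one] at h
          exact hx (h ▸ hz)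
    · intro k _ hk
      apply Finset.sum_eq_zero
      intro z _
      rw [if_neg, mul_zero]
      rintro ⟨h, _⟩
      exact hk h.symm
    · intro h; exact absurd (Finset.mem_univ _) h
  have hdd : ∀ m x, dif m u2 x = dif m u' x := by
    intro m x
    obtain ⟨Q, hQ⟩ := local_det s m (by rw [hs.closure]; trivial)
    exact hQ _ _ _ (fun q _ => hu2 _ _)
  -- choose n large
  let NN : ℕ := ∑ k, ∑ z ∈ (hfin k).toFinset, N k z⁻¹
  have hNN : ∀ k, ∀ z ∈ (hfin k).toFinset, N k z⁻¹ ≤ NN + 1 := by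
    intro k z hz
    have h1 : N k z⁻¹ ≤ ∑ z ∈ (hfin k).toFinset, N k z⁻¹ :=
      Finset.single_le_sum (f := fun z => N k z⁻¹) (fun _ _ => Nat.zero_le _) hz
    have h2 : ∑ z ∈ (hfin k).toFinset, N k z⁻¹ ≤ NN :=
      Finset.single_le_sum (f := fun k => ∑ z ∈ (hfin k).toFinset, N k z⁻¹)
        (fun _ _ => Nat.zero_le _) (Finset.mem_univ k)
    omega
  have heq : u2 (g ^ (NN + 1)) = u2 (g⁻¹ ^ (NN + 1)) := by
    simp only [u2]
    apply Finset.sum_congr rfl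
    intro k _
    apply Finset.sum_congr rfl
    intro z hz
    have := hLN k z⁻¹ (NN + 1) (hNN k z hz)
    rw [this.1, this.2]
  have h3 := hdd ((g⁻¹ ^ (NN + 1))⁻¹ * g ^ (NN + 1)) (g⁻¹ ^ (NN + 1))
  simp only [dif, mul_inv_cancel_left, heq, hp, hm] at h3
  linarith

theorem stab_triv [IsMulTorsionFree G] (A : Set G)
    (hA : A.indicator (1 : G → ℝ) ∈ UU (⊤ : Subgroup G)) {x y : G} (hx : x ∈ A) (hy : y ∉ A)
    (g : G) (hgA : ∀ t, t ∈ A ↔ g * t ∈ A) : g = 1 := by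
  by_contra hg
  have hfin := hA (x⁻¹ * y) trivial
  have h1 := hfin.preimage (f := fun n : ℕ => g ^ n * x)
    (fun a _ b _ h => pow_inj_of_ne_one hg (mul_right_cancel h))
  have hpow : ∀ n : ℕ, ∀ t, t ∈ A ↔ g ^ n * t ∈ A := by
    intro n
    induction n with
    | zero => simp
    | succ n ih => intro t; rw [pow_succ', mul_assoc, ← hgA, ih]
  apply Set.infinite_univ (α := ℕ)
  convert h1
  ext n
  simp only [Set.mem_univ, Set.mem_preimage, mem_support, dif, true_iff]
  have e1 : g ^ n * x * (x⁻¹ * y) = g ^ n * y := by group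
  rw [e1]
  have a1 := (hpow n x).1 hx
  have a2 : g ^ n * y ∉ A := fun h => hy ((hpow n y).2 h)
  simp [a1, a2]

theorem thmE {κ : Type*} [Finite κ] {s : κ → G} (hs : FB s (⊤ : Subgroup G))
    [IsMulTorsionFree G] (φ : G ≃* G) (m : ℕ) (hm0 : 0 < m) (hm : ∀ x, (⇑φ)^[m] x = x) :
    ∃ E : Set (Set G), (∀ A ∈ E, Aᶜ ∈ E) ∧ (∀ A ∈ E, ∀ B ∈ E, Nested A B) ∧
      (∀ A ∈ E, A.indicator (1 : G → ℝ) ∈ UU (⊤ : Subgroup G)) ∧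
      (∀ x y, {A ∈ E | x ∈ A ∧ y ∉ A}.Finite) ∧
      (∀ h, φ h = h → ∀ A ∈ E, (fun x => h * x) '' A ∈ E) ∧
      (∀ g, φ g = g → g ≠ 1 → ∃ A ∈ E, ∃ N : ℕ, ∀ n ≥ N, g ^ n ∈ A ∧ g⁻¹ ^ n ∉ A) ∧
      (∀ A ∈ E, ∀ z, φ z = z → ∀ x, x ∈ A → x * z ∉ A → φ x = x) := by
  classical
  let T : Set G := {t | ∃ i : ℕ, ∃ k, t = (⇑φ)^[i] (s k) ∨ t = ((⇑φ)^[i] (s k))⁻¹}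
  have hTfin : T.Finite := by
    have : T ⊆ ⋃ i ∈ Finset.range m, ⋃ k, {(⇑φ)^[i] (s k), ((⇑φ)^[i] (s k))⁻¹} := by
      rintro t ⟨i, k, h⟩
      simp only [Set.mem_iUnion]
      refine ⟨i % m, Finset.mem_range.2 (Nat.mod_lt _ hm0), k, ?_⟩
      have : (⇑φ)^[i % m] (s k) = (⇑φ)^[i] (s k) :=
        IsPeriodicPt.iterate_mod_apply (hm (s k)) i
      rw [this]
      simpa using h
    refine Set.Finite.subset (Set.Finite.biUnion (Finset.finite_toSet _) fun i _ => ?_) this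
    exact Set.finite_iUnion fun k => by simp
  have hTinv : ∀ t ∈ T, t⁻¹ ∈ T := by
    rintro t ⟨i, k, h | h⟩
    · exact ⟨i, k, Or.inr (by rw [h])⟩
    · exact ⟨i, k, Or.inl (by rw [h, inv_inv])⟩
  have hTφ : ∀ t ∈ T, φ t ∈ T := by
    rintro t ⟨i, k, h | h⟩
    · exact ⟨i + 1, k, Or.inl (by rw [h, iterate_succ_apply'])⟩
    · exact ⟨i + 1, k, Or.inr (by rw [h, iterate_succ_apply', map_inv])⟩
  have hTφi : ∀ j t, t ∈ T → (⇑φ)^[j] t ∈ T := by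
    intro j
    induction j with
    | zero => intro t ht; exact ht
    | succ j ih => intro t ht; rw [iterate_succ_apply]; exact ih _ (hTφ t ht)
  have hTφ' : ∀ t, φ t ∈ T → t ∈ T := by
    intro t ht
    have := hTφi (m - 1) _ ht
    rwa [← iterate_succ_apply, Nat.succ_eq_add_one, Nat.sub_add_cancel hm0, hm] at this
  let X : SimpleGraph G :=
    { Adj := fun x y => x ≠ y ∧ x⁻¹ * y ∈ T
      symm := ⟨fun x y h => ⟨h.1.symm, by simpa using hTinv _ h.2⟩⟩
      loopless := ⟨fun x h => h.1 rfl⟩ }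
  have hXadj : ∀ x y, X.Adj x y ↔ x ≠ y ∧ x⁻¹ * y ∈ T := fun x y => Iff.rfl
  have hsT : ∀ k, s k ∈ T := fun k => ⟨0, k, Or.inl rfl⟩
  have hXc : X.Preconnected := by
    have key : ∀ g ∈ Subgroup.closure (Set.range s), ∀ x, X.Reachable x (x * g) := by
      intro g hg
      induction hg using Subgroup.closure_induction with
      | mem t ht =>
        obtain ⟨k, rfl⟩ := ht
        intro x
        by_cases h : x = x * s k
        · rw [← h]
        · apply SimpleGraph.Adj.reachable
          exact ⟨h, by simpa using hsT k⟩
      | one => intro x; simp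
      | mul a b _ _ ha hb => intro x; rw [← mul_assoc]; exact (ha x).trans (hb _)
      | inv a _ ha => intro x; have := ha (x * a⁻¹); simp at this; exact this.symm
    intro x y
    have := key (x⁻¹ * y) (by rw [hs.closure]; trivial) x
    simpa using this
  -- elementary functions
  have := fun k => lemU' hs (fun i x => if i = k ∧ x = 1 then 1 else 0) (by
    intro i
    apply (Set.finite_singleton (1 : G)).subset
    intro z hz
    simp at hz; simp [hz.2])
  choose uk huk hdk using this
  let P : (G → ℝ) → Set (G × G) := fun u => {p | p.1⁻¹ * p.2 ∈ T ∧ u p.1 ≠ u p.2}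
  have hPfin : ∀ u ∈ UU (⊤ : Subgroup G), (P u).Finite := by
    intro u hu
    have : P u ⊆ ⋃ t ∈ T, (fun x => (x, x * t)) '' support (dif t u) := by
      rintro ⟨x, y⟩ ⟨h1, h2⟩
      simp only [Set.mem_iUnion]
      refine ⟨x⁻¹ * y, h1, x, ?_, by simp⟩
      simp only [mem_support, dif, mul_inv_cancel_left]
      intro h; apply h2; simp only; linarith
    exact (Set.Finite.biUnion hTfin fun t _ => (hu t trivial).image _).subset this
  have hPtr : ∀ u z, (P (fun x => u (z * x))).encard = (P u).encard := by
    intro u z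
    have : P u = Prod.map (fun x => z * x) (fun x => z * x) '' P (fun x => u (z * x)) := by
      ext ⟨x, y⟩
      simp only [P, Set.mem_ofPred_eq, Set.mem_image, Prod.exists, Prod.map_apply, Prod.mk.injEq]
      constructor
      · rintro ⟨h1, h2⟩
        exact ⟨z⁻¹ * x, z⁻¹ * y, ⟨by simpa [mul_assoc] using h1, by simpa using h2⟩, by simp, by simp⟩
      · rintro ⟨a, b, ⟨h1, h2⟩, rfl, rfl⟩
        exact ⟨by simpa [mul_assoc] using h1, h2⟩
    rw [this, Set.InjOn.encard_image
      (Function.Injective.prodMap (mul_right_injective z) (mul_right_injective z)).injOn]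
  have := Fintype.ofFinite κ
  let K0 : ℕ := ∑ k, (P (uk k)).ncard
  have hK0 : ∀ k, (P (uk k)).encard ≤ K0 := by
    intro k
    rw [← (hPfin _ (huk k)).cast_ncard_eq]
    exact_mod_cast Finset.single_le_sum (f := fun k => (P (uk k)).ncard)
      (fun _ _ => Nat.zero_le _) (Finset.mem_univ k)
  obtain ⟨E, hE1, hE2, hE3, hE4, hE5, hE6⟩ := nest_main X hXc K0
  have hUU : ∀ A ∈ E, A.indicator (1 : G → ℝ) ∈ UU (⊤ : Subgroup G) := by
    intro A hA
    rw [← hs.closure]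
    apply UU_of_gen
    intro k
    apply (((hE3 A hA).image Prod.fst).union ((hE3 A hA).image Prod.snd)).subset
    intro x hx
    simp only [mem_support, dif] at hx
    by_cases h1 : x ∈ A <;> by_cases h2 : x * s k ∈ A
    · simp [h1, h2] at hx
    · left
      exact ⟨(x, x * s k), ⟨⟨fun h => h2 ((show x = x * s k from h) ▸ h1), by simpa using hsT k⟩, h1, h2⟩, rfl⟩
    · right
      exact ⟨(x * s k, x), ⟨⟨fun h => h1 ((show x * s k = x from h) ▸ h2), by simpa using hTinv _ (hsT k)⟩, h2, h1⟩, rfl⟩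
    · simp [h1, h2] at hx
  have hleft : ∀ g, ∀ A ∈ E, (fun x => g * x) '' A ∈ E := by
    intro g A hA
    exact hE5 (Equiv.mulLeft g) (by intro x y; simp [hXadj, mul_assoc]) A hA
  have hphi : ∀ A ∈ E, φ '' A ∈ E := by
    intro A hA
    refine hE5 φ.toEquiv ?_ A hA
    intro x y
    simp only [MulEquiv.toEquiv_eq_coe, EquivLike.coe_coe, hXadj, ne_eq, EmbeddingLike.apply_eq_iff_eq]
    rw [← map_inv, ← map_mul]
    exact and_congr_right fun _ => ⟨hTφ' _, hTφ _⟩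
  have hsymm : ∀ x, φ.symm x = (⇑φ)^[m - 1] x := by
    intro x
    rw [MulEquiv.symm_apply_eq, ← iterate_succ_apply' (⇑φ), Nat.succ_eq_add_one, Nat.sub_add_cancel hm0, hm]
  have hm' : ∀ x, (⇑φ.symm)^[m] x = x := by
    intro x
    have h1 : LeftInverse (⇑φ.symm)^[m] (⇑φ)^[m] := LeftInverse.iterate φ.symm_apply_apply m
    have := h1 x
    rwa [hm] at this
  have hsymm' : ∀ x, φ x = (⇑φ.symm)^[m - 1] x := by
    intro x
    rw [← MulEquiv.eq_symm_apply, ← iterate_succ_apply' (⇑φ.symm), Nat.succ_eq_add_one, Nat.sub_add_cancel hm0, hm']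
  have hchain : ∀ A ∈ E, ∀ p q, φ p = p → φ q = q → p ∈ A → q ∉ A → φ '' A = A := by
    intro A hA p q hp hq hpA hqA
    have hn := hE2 A hA _ (hphi A hA)
    have hp2 : p ∈ φ '' A := ⟨p, hpA, hp⟩
    have hq2 : q ∉ φ '' A := by
      rintro ⟨r, hr, hr2⟩
      rw [← hq] at hr2
      exact hqA (φ.injective hr2 ▸ hr)
    rcases hn with h | h | h | h
    · exact absurd (Set.mem_inter hpA hp2) (by rw [h]; simp)
    · have hsub : Set.MapsTo φ.symm A A := by
        intro x hx
        by_contra hc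
        have : x ∈ A ∩ (φ '' A)ᶜ := ⟨hx, by rintro ⟨r, hr, rfl⟩; exact hc (by simpa using hr)⟩
        rw [h] at this; exact this
      ext x
      constructor
      · rintro ⟨r, hr, rfl⟩
        rw [hsymm']; exact hsub.iterate _ hr
      · intro hx; exact ⟨φ.symm x, hsub hx, by simp⟩
    · have hsub : Set.MapsTo φ A A := by
        intro x hx
        by_contra hc
        have : φ x ∈ Aᶜ ∩ (φ '' A) := ⟨hc, ⟨x, hx, rfl⟩⟩
        rw [h] at this; exact this
      ext x
      constructor
      · rintro ⟨r, hr, rfl⟩; exact hsub hr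
      · intro hx
        refine ⟨φ.symm x, ?_, by simp⟩
        rw [hsymm]; exact hsub.iterate _ hx
    · exact absurd (Set.mem_inter (show q ∈ Aᶜ from hqA) (show q ∈ (φ '' A)ᶜ from hq2)) (by rw [h]; simp)
  refine ⟨{A ∈ E | φ '' A = A}, ?_, ?_, ?_, ?_, ?_, ?_, ?_⟩
  · rintro A ⟨hA, hA2⟩
    exact ⟨hE1 A hA, by rw [Set.image_compl_eq φ.bijective, hA2]⟩
  · rintro A ⟨hA, _⟩ B ⟨hB, _⟩; exact hE2 A hA B hB
  · rintro A ⟨hA, _⟩; exact hUU A hA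
  · intro x y
    exact (hE4 x y).subset (fun A hA => ⟨hA.1.1, hA.2⟩)
  · rintro h hh A ⟨hA, hA2⟩
    refine ⟨hleft h A hA, ?_⟩
    conv_rhs => rw [← hA2]
    rw [← Set.image_comp, ← Set.image_comp]
    congr 1; ext x; simp [hh]
  · intro g hg hg1
    obtain ⟨k, z, L1, L2, hL, N, hN⟩ := sep_ends hs uk huk (fun k i x => by rw [hdk]) g hg1
    let U := Ultrafilter.of (Filter.map (fun n : ℕ => g ^ n) Filter.atTop)
    let W := Ultrafilter.of (Filter.map (fun n : ℕ => g⁻¹ ^ n) Filter.atTop)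
    have hU : ∀ B : Set G, (∀ᶠ n : ℕ in Filter.atTop, g ^ n ∈ B) → B ∈ U := fun B hB =>
      Ultrafilter.of_le (Filter.map (fun n : ℕ => g ^ n) Filter.atTop) hB
    have hW : ∀ B : Set G, (∀ᶠ n : ℕ in Filter.atTop, g⁻¹ ^ n ∈ B) → B ∈ W := fun B hB =>
      Ultrafilter.of_le (Filter.map (fun n : ℕ => g⁻¹ ^ n) Filter.atTop) hB
    obtain ⟨A, hAE, hAU, hAW⟩ := hE6 U W ⟨{x | uk k (z * x) ≠ L2}, hU _ (by
        filter_upwards [Filter.eventually_ge_atTop N] with n hn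
        rw [(hN n hn).1]; exact hL), hW _ (by
        filter_upwards [Filter.eventually_ge_atTop N] with n hn
        simpa using (hN n hn).2), by
        refine le_trans (Set.encard_le_encard ?_) ((hPtr (uk k) z).trans_le (hK0 k))
        rintro ⟨x, y⟩ ⟨h1, h2, h3⟩
        simp only [Set.mem_ofPred_eq, not_not] at h2 h3
        exact ⟨h1.2, by simp only; rw [h3]; exact h2⟩⟩
    have ev : ∀ g' : G, g' ≠ 1 → (∀ᶠ n : ℕ in Filter.atTop, g' ^ n ∈ A) ∨
        (∀ᶠ n : ℕ in Filter.atTop, g' ^ n ∈ Aᶜ) := by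
      intro g' hg'
      obtain ⟨L, M, hM⟩ := ev_const hg' _ (hUU A hAE g' trivial)
      by_cases hL : L = 1
      · left
        filter_upwards [Filter.eventually_ge_atTop M] with n hn
        by_contra hc
        have := hM n hn
        rw [Set.indicator_of_notMem hc, hL] at this
        norm_num at this
      · right
        filter_upwards [Filter.eventually_ge_atTop M] with n hn
        intro hc
        have := hM n hn
        rw [Set.indicator_of_mem hc] at this
        exact hL this.symm
    have hA1 : ∀ᶠ n : ℕ in Filter.atTop, g ^ n ∈ A := by
      rcases ev g hg1 with h | h
      · exact h
      · exact absurd hAU (Ultrafilter.compl_mem_iff_notMem.1 (hU _ h))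
    have hA2 : ∀ᶠ n : ℕ in Filter.atTop, g⁻¹ ^ n ∈ Aᶜ := by
      rcases ev g⁻¹ (inv_ne_one.2 hg1) with h | h
      · exact absurd (hW _ h) (Ultrafilter.compl_mem_iff_notMem.1 hAW)
      · exact h
    obtain ⟨N', hN'⟩ := Filter.eventually_atTop.1 (hA1.and hA2)
    refine ⟨A, ⟨hAE, ?_⟩, N', hN'⟩
    exact hchain A hAE (g ^ N') (g⁻¹ ^ N') (by simp [hg]) (by simp [hg]) (hN' _ le_rfl).1 (hN' _ le_rfl).2
  · rintro A ⟨hA, hA2⟩ z hz x hx hxz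
    have h1 := hchain _ (hleft x⁻¹ A hA) 1 z (map_one φ) hz ⟨x, hx, by simp⟩ (by
      rintro ⟨r, hr, hrz⟩
      apply hxz
      rw [← hrz]; simpa using hr)
    have hAφ : ∀ t, φ t ∈ A ↔ t ∈ A := by
      intro t
      conv_lhs => rw [← hA2]
      exact ⟨fun ⟨r, hr, h⟩ => φ.injective h ▸ hr, fun h => ⟨t, h, rfl⟩⟩
    have h2 : ∀ t, x * t ∈ A ↔ φ x * t ∈ A := by
      intro t
      have e1 : x * t ∈ A ↔ t ∈ (fun y => x⁻¹ * y) '' A := by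
        constructor
        · intro h; exact ⟨_, h, by simp⟩
        · rintro ⟨r, hr, rfl⟩; simpa using hr
      have e2 : t ∈ φ '' ((fun y => x⁻¹ * y) '' A) ↔ φ x * t ∈ A := by
        constructor
        · rintro ⟨_, ⟨r, hr, rfl⟩, rfl⟩
          simp only [map_mul, map_inv, mul_inv_cancel_left]
          exact (hAφ r).2 hr
        · intro h
          refine ⟨φ.symm t, ⟨x * φ.symm t, ?_, by simp⟩, by simp⟩
          rw [← hAφ]; simpa using h
      rw [e1, ← e2, h1]
    have h3 := stab_triv A (hUU A hA) hx hxz (φ x * x⁻¹) (by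
      intro t
      have := h2 (x⁻¹ * t)
      simpa [mul_assoc] using this)
    exact mul_inv_eq_one.1 h3

end cuts
end S8

namespace S8
open Function
section tree
variable {G : Type*}

def vx (E : Set (Set G)) (p : G) : Set (Set G) := {B | B ∈ E ∧ p ∈ B}
def vA (E : Set (Set G)) (A : Set G) : Set (Set G) := {B | B ∈ E ∧ (A ⊆ B ∨ Bᶜ ⊂ A)}
def Sp (E : Set (Set G)) (p q : G) : Set (Set G) := {A ∈ E | p ∈ A ∧ q ∉ A}

theorem nested_iff {A B : Set G} : Nested A B ↔ (A ⊆ Bᶜ ∨ A ⊆ B ∨ B ⊆ A ∨ Bᶜ ⊆ A) := by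
  unfold Nested
  simp only [← Set.disjoint_iff_inter_eq_empty, Set.disjoint_compl_right_iff_subset,
    Set.disjoint_compl_left_iff_subset, Set.subset_compl_iff_disjoint_right]
  rw [Set.compl_subset_comm (s := A)]

variable {E : Set (Set G)}

theorem cssc {A B : Set G} : Aᶜ ⊂ Bᶜ ↔ B ⊂ A := by
  rw [Set.ssubset_def, Set.ssubset_def, Set.compl_subset_compl, Set.compl_subset_compl]

theorem tr1 (hc : ∀ A ∈ E, Aᶜ ∈ E) (hn : ∀ A ∈ E, ∀ B ∈ E, Nested A B)
    {p q : G} {A : Set G} (hA : A ∈ Sp E p q)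
    (hmin : ∀ B ∈ Sp E p q, B ⊆ A → B = A) : vx E p = vA E A := by
  obtain ⟨hAE, hpA, hqA⟩ := hA
  ext B
  constructor
  · rintro ⟨hB, hp⟩
    refine ⟨hB, ?_⟩
    rcases nested_iff.1 (hn A hAE B hB) with h | h | h | h
    · exact absurd hp (h hpA)
    · exact Or.inl h
    · left; rw [hmin B ⟨hB, hp, fun h' => hqA (h h')⟩ h]
    · right
      refine ⟨h, fun h' => ?_⟩
      exact h' hpA hp
  · rintro ⟨hB, h | h⟩
    · exact ⟨hB, h hpA⟩
    · refine ⟨hB, ?_⟩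
      by_contra hp
      have := hmin Bᶜ ⟨hc B hB, hp, fun h' => hqA (h.1 h')⟩ h.1
      exact h.2 this.symm.subset

theorem tr2 (hc : ∀ A ∈ E, Aᶜ ∈ E) (hn : ∀ A ∈ E, ∀ B ∈ E, Nested A B)
    {p q : G} {A : Set G} (hA : A ∈ Sp E p q)
    (hmax : ∀ B ∈ Sp E p q, A ⊆ B → B = A) : vA E Aᶜ = vx E q := by
  symm
  refine tr1 hc hn (p := q) (q := p) ⟨hc A hA.1, hA.2.2, fun h => h hA.2.1⟩ ?_
  rintro B ⟨hB, h1, h2⟩ hBA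
  have := hmax Bᶜ ⟨hc B hB, h2, fun h => h h1⟩ (Set.subset_compl_comm.1 hBA)
  rw [← this, compl_compl]

theorem tr3 (hc : ∀ A ∈ E, Aᶜ ∈ E) (hn : ∀ A ∈ E, ∀ B ∈ E, Nested A B)
    {p q : G} {A A' : Set G} (hA : A ∈ Sp E p q) (hA' : A' ∈ Sp E p q) (hAA : A ⊂ A')
    (hcon : ∀ B ∈ Sp E p q, A ⊆ B → B ⊆ A' → B = A ∨ B = A') : vA E Aᶜ = vA E A' := by
  obtain ⟨hAE, hpA, hqA⟩ := hA
  obtain ⟨hAE', hpA', hqA'⟩ := hA'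
  ext B
  constructor
  · rintro ⟨hB, h | h⟩
    · refine ⟨hB, Or.inr ?_⟩
      exact lt_of_le_of_lt (Set.compl_subset_comm.1 h) hAA
    · refine ⟨hB, ?_⟩
      have hAB : A ⊂ B := cssc.1 h
      rcases nested_iff.1 (hn A' hAE' B hB) with h | h | h | h
      · exact absurd (hAB.1 hpA) (h hpA')
      · exact Or.inl h
      · rcases hcon B ⟨hB, hAB.1 hpA, fun h' => hqA' (h h')⟩ hAB.1 h with h1 | h1
        · exact absurd h1.subset hAB.2
        · exact Or.inl h1.symm.subset
      · right
        exact ⟨h, fun h' => h' hpA' (hAB.1 hpA)⟩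
  · rintro ⟨hB, h | h⟩
    · exact ⟨hB, Or.inr (cssc.2 (lt_of_lt_of_le hAA h))⟩
    · refine ⟨hB, ?_⟩
      rcases nested_iff.1 (hn A hAE B hB) with h1 | h1 | h1 | h1
      · rcases hcon Bᶜ ⟨hc B hB, h1 hpA, fun h' => hqA' (h.1 h')⟩ h1 h.1 with h2 | h2
        · left; rw [← h2, compl_compl]
        · exact absurd h2.symm.subset h.2
      · right
        refine cssc.2 ⟨h1, fun h2 => ?_⟩
        exact hqA' (h.1 fun h3 => hqA (h2 h3))
      · exact absurd (h.1 fun h3 => hqA (h1 h3)) hqA'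
      · left; exact Set.compl_subset_comm.1 h1

theorem tr_chain (hc : ∀ A ∈ E, Aᶜ ∈ E) (hn : ∀ A ∈ E, ∀ B ∈ E, Nested A B)
    {p q : G} {A B : Set G} (hA : A ∈ Sp E p q) (hB : B ∈ Sp E p q) :
    A ⊆ B ∨ B ⊆ A := by
  rcases nested_iff.1 (hn A hA.1 B hB.1) with h | h | h | h
  · exact absurd hB.2.1 (h hA.2.1)
  · exact Or.inl h
  · exact Or.inr h
  · exact absurd (h hB.2.2) hA.2.2

theorem tr_tele (hc : ∀ A ∈ E, Aᶜ ∈ E) (hn : ∀ A ∈ E, ∀ B ∈ E, Nested A B)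
    (f : Set (Set G) → ℝ) {p q : G} (S : Finset (Set G)) (hS : ∀ A, A ∈ S ↔ A ∈ Sp E p q) :
    ∑ A ∈ S, (f (vA E A) - f (vA E Aᶜ)) = f (vx E p) - f (vx E q) := by
  classical
  have key : ∀ n : ℕ, ∀ A ∈ S, (S.filter (· ⊆ A)).card = n →
      ∑ B ∈ S.filter (· ⊆ A), (f (vA E B) - f (vA E Bᶜ)) = f (vx E p) - f (vA E Aᶜ) := by
    intro n
    induction n using Nat.strong_induction_on with
    | _ n ih =>
    intro A hA hcard
    by_cases hmin : (S.filter (· ⊂ A)).Nonempty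
    · obtain ⟨A0, hA0, hmax⟩ := Finset.exists_maximal hmin
      rw [Finset.mem_filter] at hA0
      obtain ⟨hA0S, hA0A⟩ := hA0
      have hbet : ∀ B ∈ Sp E p q, B ⊂ A → B ⊆ A0 := by
        intro B hB hBA
        rcases tr_chain hc hn hB ((hS A0).1 hA0S) with h | h
        · exact h
        · exact hmax (Finset.mem_filter.2 ⟨(hS B).2 hB, hBA⟩) h
      have hfil : S.filter (· ⊆ A) = insert A (S.filter (· ⊆ A0)) := by
        ext B
        simp only [Finset.mem_filter, Finset.mem_insert]
        constructor
        · rintro ⟨h3, h4⟩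
          by_cases h5 : B = A
          · exact Or.inl h5
          · exact Or.inr ⟨h3, hbet B ((hS B).1 h3) (lt_of_le_of_ne h4 h5)⟩
        · rintro (h3 | ⟨h3, h4⟩)
          · subst h3; exact ⟨hA, subset_rfl⟩
          · exact ⟨h3, h4.trans hA0A.1⟩
      have hnot : A ∉ S.filter (· ⊆ A0) := fun h => hA0A.2 (Finset.mem_filter.1 h).2
      have hc2 : (S.filter (· ⊆ A0)).card < n := by
        rw [← hcard, hfil, Finset.card_insert_of_notMem hnot]; exact Nat.lt_succ_self _
      rw [hfil, Finset.sum_insert hnot, ih _ hc2 A0 hA0S rfl,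
        tr3 hc hn ((hS A0).1 hA0S) ((hS A).1 hA) hA0A ?_]
      · ring
      · intro B hB h1 h2
        by_cases h5 : B = A
        · exact Or.inr h5
        · exact Or.inl ((hbet B hB (lt_of_le_of_ne h2 h5)).antisymm h1)
    · rw [Finset.not_nonempty_iff_eq_empty] at hmin
      have h1 : ∀ B ∈ Sp E p q, B ⊆ A → B = A := by
        intro B hB hBA
        by_contra hne
        have : B ∈ S.filter (· ⊂ A) := Finset.mem_filter.2 ⟨(hS B).2 hB, lt_of_le_of_ne hBA hne⟩
        rw [hmin] at this; simp at this
      have h2 : S.filter (· ⊆ A) = {A} := by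
        ext B
        simp only [Finset.mem_filter, Finset.mem_singleton]
        constructor
        · rintro ⟨h3, h4⟩; exact h1 B ((hS B).1 h3) h4
        · rintro rfl; exact ⟨hA, subset_rfl⟩
      rw [h2, Finset.sum_singleton, tr1 hc hn ((hS A).1 hA) h1]
  by_cases hne : S.Nonempty
  · obtain ⟨A, hA, hmax⟩ := Finset.exists_maximal hne
    have h1 : ∀ B ∈ Sp E p q, B ⊆ A := by
      intro B hB
      rcases tr_chain hc hn hB ((hS A).1 hA) with h | h
      · exact h
      · exact hmax ((hS B).2 hB) h
    have := key _ A hA rfl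
    rw [Finset.filter_true_of_mem (fun B hB => h1 B ((hS B).1 hB))] at this
    rw [this, tr2 hc hn ((hS A).1 hA) (fun B hB h => (h1 B hB).antisymm h)]
  · rw [Finset.not_nonempty_iff_eq_empty] at hne
    subst hne
    have : vx E p = vx E q := by
      ext B
      constructor
      · rintro ⟨hB, h⟩
        refine ⟨hB, ?_⟩
        by_contra h'
        simpa using (hS B).2 ⟨hB, h, h'⟩
      · rintro ⟨hB, h⟩
        refine ⟨hB, ?_⟩
        by_contra h'
        simpa using (hS Bᶜ).2 ⟨hc B hB, h', fun h2 => h2 h⟩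
    simp [this]

theorem tr_good (hc : ∀ A ∈ E, Aᶜ ∈ E) (hn : ∀ A ∈ E, ∀ B ∈ E, Nested A B)
    {p q : G} {A : Set G} (hA : A ∈ Sp E p q) (B : Set G)
    (hB : ¬ (B ∈ vA E A ↔ B ∈ vx E p)) : B ∈ Sp E p q ∨ B ∈ Sp E q p := by
  obtain ⟨hAE, hpA, hqA⟩ := hA
  by_cases h1 : B ∈ vA E A
  · have h2 : B ∉ vx E p := fun h => hB ⟨fun _ => h, fun _ => h1⟩
    obtain ⟨hBE, h | h⟩ := h1
    · exact absurd ⟨hBE, h hpA⟩ h2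
    · right
      refine ⟨hBE, ?_, fun h3 => h2 ⟨hBE, h3⟩⟩
      by_contra h3
      exact hqA (h.1 h3)
  · have h2 : B ∈ vx E p := by
      by_contra h; exact hB ⟨fun h' => absurd h' h1, fun h' => absurd h' h⟩
    left
    refine ⟨h2.1, h2.2, fun hqB => h1 ⟨h2.1, ?_⟩⟩
    rcases nested_iff.1 (hn A hAE B h2.1) with h | h | h | h
    · exact absurd h2.2 (h hpA)
    · exact Or.inl h
    · exact absurd (h hqB) hqA
    · exact Or.inr ⟨h, fun h' => h' hpA h2.2⟩

end tree

theorem exists_nu {H V : Type*} [Group H] [MulAction H V] (v0 : V) (h0 : ∀ g : H, g • v0 = v0 → g = 1) :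
    ∃ ν : V → H, ν v0 = 1 ∧ ∀ v, (∀ g : H, g • v = v → g = 1) → ∀ g : H, ν (g • v) = g * ν v := by
  classical
  let Q := MulAction.orbitRel.Quotient H V
  let mk : V → Q := Quotient.mk _
  have hmk : ∀ (g : H) v, mk (g • v) = mk v := fun g v =>
    Quotient.sound (MulAction.orbitRel_apply.2 ⟨g, rfl⟩)
  let r : Q → V := fun q => if q = mk v0 then v0 else q.out
  have hr : ∀ q, mk (r q) = q := by
    intro q
    by_cases h : q = mk v0
    · simp [r, h]
    · simp only [r, h, if_false]; exact Quotient.out_eq q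
  have hex : ∀ v, ∃ g : H, g • r (mk v) = v := by
    intro v
    have : mk v = mk (r (mk v)) := (hr _).symm
    obtain ⟨g, hg⟩ := MulAction.orbitRel_apply.1 (Quotient.exact this)
    exact ⟨g, hg⟩
  choose ν hν using hex
  refine ⟨ν, ?_, ?_⟩
  · have h1 := hν v0
    simp only [r, if_true] at h1
    exact h0 _ h1
  · intro v hv g
    have h1 := hν (g • v)
    have h2 := hν v
    rw [hmk] at h1
    have h3 : r (mk v) = (ν v)⁻¹ • v := by rw [eq_inv_smul_iff, h2]
    rw [h3, ← mul_smul] at h1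
    have h4 : (g⁻¹ * (ν (g • v) * (ν v)⁻¹)) • v = v := by
      rw [mul_smul, h1, inv_smul_smul]
    have h5 := hv _ h4
    rw [inv_mul_eq_one, eq_mul_inv_iff_mul_eq] at h5
    exact h5.symm

end S8

namespace S8
open Function
section propA
open scoped Pointwise
variable {G : Type*} [Group G]

theorem smul_vx {E : Set (Set G)} {g : G} (h1 : ∀ A ∈ E, g • A ∈ E) (h2 : ∀ A ∈ E, g⁻¹ • A ∈ E) (p : G) :
    g • vx E p = vx E (g * p) := by
  ext B
  rw [Set.mem_smul_set_iff_inv_smul_mem]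
  constructor
  · rintro ⟨h3, h4⟩
    refine ⟨by simpa using h1 _ h3, ?_⟩
    rw [Set.mem_smul_set_iff_inv_smul_mem, inv_inv] at h4
    exact h4
  · rintro ⟨h3, h4⟩
    refine ⟨h2 _ h3, ?_⟩
    rw [Set.mem_smul_set_iff_inv_smul_mem, inv_inv]
    exact h4

theorem smul_vA {E : Set (Set G)} {g : G} (h1 : ∀ A ∈ E, g • A ∈ E) (h2 : ∀ A ∈ E, g⁻¹ • A ∈ E) (A : Set G) :
    g • vA E A = vA E (g • A) := by
  have e1 : ∀ B : Set G, A ⊆ g⁻¹ • B ↔ g • A ⊆ B := fun B => by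
    rw [Set.subset_smul_set_iff, inv_inv]
  have e2 : ∀ B : Set G, (g⁻¹ • B)ᶜ ⊂ A ↔ Bᶜ ⊂ g • A := fun B => by
    rw [← Set.smul_set_compl, Set.ssubset_def, Set.ssubset_def, Set.subset_smul_set_iff,
      Set.subset_smul_set_iff, Set.smul_set_subset_iff_subset_inv_smul_set, inv_inv]
  ext B
  rw [Set.mem_smul_set_iff_inv_smul_mem]
  simp only [vA, Set.mem_ofPred_eq, e1, e2]
  exact and_congr_left fun _ => ⟨fun h => by simpa using h1 _ h, h2 B⟩

theorem free_good [IsMulTorsionFree G] {E : Set (Set G)}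
    (hU : ∀ A ∈ E, A.indicator (1 : G → ℝ) ∈ UU (⊤ : Subgroup G)) {g : G}
    (h1 : ∀ A ∈ E, g • A ∈ E) (h2 : ∀ A ∈ E, g⁻¹ • A ∈ E)
    {B : Set G} (hB : B ∈ E) {N : ℕ} (hN : ∀ n ≥ N, g ^ n ∈ B ∧ g⁻¹ ^ n ∉ B)
    (v : Set (Set G)) (hv : {C | ¬ (C ∈ v ↔ C ∈ vx E 1)}.Finite) (hg1 : g ≠ 1) : g • v ≠ v := by
  intro hgv
  have hp : ∀ n : ℕ, g ^ n • B ∈ E := by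
    intro n; induction n with
    | zero => simpa using hB
    | succ n ih => rw [pow_succ', mul_smul]; exact h1 _ ih
  have hm : ∀ n : ℕ, g⁻¹ ^ n • B ∈ E := by
    intro n; induction n with
    | zero => simpa using hB
    | succ n ih => rw [pow_succ', mul_smul]; exact h2 _ ih
  have hgv' : g⁻¹ • v = v := by rw [inv_smul_eq_iff, hgv]
  have hpv : ∀ n : ℕ, g ^ n • v = v := by
    intro n; induction n with
    | zero => simp
    | succ n ih => rw [pow_succ', mul_smul, ih, hgv]
  have hmv : ∀ n : ℕ, g⁻¹ ^ n • v = v := by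
    intro n; induction n with
    | zero => simp
    | succ n ih => rw [pow_succ', mul_smul, ih, hgv']
  have hinj : ∀ h : G, h • B = B → h = 1 := by
    intro h hh
    refine stab_triv B (hU B hB) (hN N le_rfl).1 (hN N le_rfl).2 h fun t => ?_
    conv_rhs => rw [← hh]
    exact (Set.smul_mem_smul_set_iff (a := h)).symm
  have inj : ∀ k : G, k ≠ 1 → Injective (fun n : ℕ => k ^ (n + N) • B) := by
    intro k hk a b hab
    have : ((k ^ (b + N))⁻¹ * k ^ (a + N)) • B = B := by
      rw [mul_smul, inv_smul_eq_iff]; exact hab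
    have := hinj _ this
    rw [inv_mul_eq_one] at this
    have := pow_inj_of_ne_one hk this
    omega
  by_cases hBv : B ∈ v
  · have : Set.range (fun n : ℕ => g ^ (n + N) • B) ⊆ {C | ¬ (C ∈ v ↔ C ∈ vx E 1)} := by
      rintro _ ⟨n, rfl⟩ h
      have h3 : g ^ (n + N) • B ∈ v := by
        rw [← hpv (n + N)]; exact Set.smul_mem_smul_set hBv
      have h4 := (h.1 h3).2
      rw [Set.mem_smul_set_iff_inv_smul_mem, smul_eq_mul, mul_one, ← inv_pow] at h4
      exact (hN (n + N) (by omega)).2 h4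
    exact Set.infinite_range_of_injective (inj g hg1) (hv.subset this)
  · have : Set.range (fun n : ℕ => g⁻¹ ^ (n + N) • B) ⊆ {C | ¬ (C ∈ v ↔ C ∈ vx E 1)} := by
      rintro _ ⟨n, rfl⟩ h
      have h3 : g⁻¹ ^ (n + N) • B ∈ vx E 1 := by
        refine ⟨hm _, ?_⟩
        rw [Set.mem_smul_set_iff_inv_smul_mem, smul_eq_mul, mul_one, ← inv_pow, inv_inv]
        exact (hN (n + N) (by omega)).1
      have h4 := h.2 h3
      rw [← hmv (n + N), Set.smul_mem_smul_set_iff] at h4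
      exact hBv h4
    exact Set.infinite_range_of_injective (inj g⁻¹ (by simpa using hg1)) (hv.subset this)

theorem propA {κ : Type*} [Finite κ] {s : κ → G} (hs : FB s (⊤ : Subgroup G))
    [IsMulTorsionFree G] (φ : G ≃* G) (m : ℕ) (hm0 : 0 < m) (hm : ∀ x, (⇑φ)^[m] x = x)
    (H : Subgroup G) (hH : ∀ x, x ∈ H ↔ φ x = x) {ι : Type*} [Finite ι] (z : ι → G)
    (hz : ∀ j, z j ∈ H) (u : G → ℝ) (hu : u ∈ UU H) :
    ∃ u' ∈ UU (⊤ : Subgroup G), (∀ j, ∀ x ∈ H, dif (z j) u' x = dif (z j) u x) ∧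
      ∀ j, ∀ x ∉ H, dif (z j) u' x = 0 := by
  classical
  obtain ⟨E, hc, hn, hU, hfin, hinv, hax, hfix⟩ := thmE hs φ m hm0 hm
  have hinv1 : ∀ g ∈ H, ∀ A ∈ E, g • A ∈ E := fun g hg A hA => hinv g ((hH g).1 hg) A hA
  have hinv2 : ∀ g ∈ H, ∀ A ∈ E, g⁻¹ • A ∈ E := fun g hg A hA =>
    hinv1 _ (H.inv_mem hg) A hA
  have hfree : ∀ v : Set (Set G), {C | ¬ (C ∈ v ↔ C ∈ vx E 1)}.Finite →
      ∀ g : H, g • v = v → g = 1 := by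
    intro v hv g hgv
    by_contra hg1
    have hg1' : (g : G) ≠ 1 := by simpa using hg1
    obtain ⟨B, hB, N, hN⟩ := hax g ((hH _).1 g.2) hg1'
    exact free_good hU (hinv1 g g.2) (hinv2 g g.2) hB hN v hv hg1' hgv
  have hgoodx : ∀ x, {C | ¬ (C ∈ vx E x ↔ C ∈ vx E 1)}.Finite := by
    intro x
    refine ((hfin x 1).union (hfin 1 x)).subset fun C hC => ?_
    have hC' : ¬ (C ∈ vx E x ↔ C ∈ vx E 1) := hC
    by_cases h1 : C ∈ vx E x
    · left
      exact ⟨h1.1, h1.2, fun h => hC' ⟨fun _ => ⟨h1.1, h⟩, fun _ => h1⟩⟩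
    · have h2 : C ∈ vx E 1 := by
        by_contra h2; exact hC' ⟨fun h => absurd h h1, fun h => absurd h h2⟩
      right
      exact ⟨h2.1, h2.2, fun h => h1 ⟨h2.1, h⟩⟩
  have hgoodA : ∀ p q A, A ∈ Sp E p q → {C | ¬ (C ∈ vA E A ↔ C ∈ vx E 1)}.Finite := by
    intro p q A hA
    refine (((hfin p q).union (hfin q p)).union (hgoodx p)).subset fun C hC => ?_
    by_cases h : C ∈ vA E A ↔ C ∈ vx E p
    · right
      exact fun h' => hC (h.trans h')
    · left
      exact tr_good hc hn hA C h
  obtain ⟨ν, hν1, hν⟩ := exists_nu (H := H) (vx E 1) (hfree _ (hgoodx 1))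
  have hνx : ∀ x (hx : x ∈ H), (ν (vx E x) : G) = x := by
    intro x hx
    have h1 := hν (vx E 1) (hfree _ (hgoodx 1)) ⟨x, hx⟩
    have h2 : (⟨x, hx⟩ : H) • vx E 1 = vx E x := by
      have := smul_vx (hinv1 x hx) (hinv2 x hx) 1
      rw [mul_one] at this; exact this
    rw [h2, hν1, mul_one] at h1
    rw [h1]
  let f : Set (Set G) → ℝ := fun v => u (ν v)
  let w : Set G → ℝ := fun A => f (vA E A) - f (vA E Aᶜ)
  have hcS : ∀ p q A, A ∈ Sp E p q → Aᶜ ∈ Sp E q p := fun p q A hA =>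
    ⟨hc A hA.1, hA.2.2, fun h => h hA.2.1⟩
  have hwfin : ∀ p q A, A ∈ Sp E p q → {C | ∃ g ∈ H, C = g • A ∧ w C ≠ 0}.Finite := by
    intro p q A hA
    set a : H := ν (vA E A) with ha
    set b : H := ν (vA E Aᶜ) with hb
    have h1 : ∀ g (hg : g ∈ H), w (g • A) = - dif ((a : G)⁻¹ * b) u (g * a) := by
      intro g hg
      have e1 := hν (vA E A) (hfree _ (hgoodA p q A hA)) ⟨g, hg⟩
      have e2 := hν (vA E Aᶜ) (hfree _ (hgoodA q p _ (hcS _ _ _ hA))) ⟨g, hg⟩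
      have e3 : (⟨g, hg⟩ : H) • vA E A = vA E (g • A) := smul_vA (hinv1 g hg) (hinv2 g hg) A
      have e4 : (⟨g, hg⟩ : H) • vA E Aᶜ = vA E (g • A)ᶜ := by
        rw [← Set.smul_set_compl]; exact smul_vA (hinv1 g hg) (hinv2 g hg) Aᶜ
      rw [e3] at e1
      rw [e4] at e2
      simp only [w, f, dif]
      rw [e1, e2]
      simp only [Subgroup.coe_mul, ← ha, ← hb]
      rw [show g * (a : G) * ((a : G)⁻¹ * b) = g * b by group]
      ring
    have h2 := hu ((a : G)⁻¹ * b) (H.mul_mem (H.inv_mem a.2) b.2)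
    refine (h2.image fun x => (x * (a : G)⁻¹) • A).subset ?_
    rintro C ⟨g, hg, rfl, hw⟩
    rw [h1 g hg] at hw
    exact ⟨g * a, by simpa using hw, by simp⟩
  let T : Set (Set G) := {A | w A ≠ 0 ∧ ∃ p ∈ H, ∃ j, A ∈ Sp E p (p * z j) ∨ A ∈ Sp E (p * z j) p}
  have hmv : ∀ p ∈ H, ∀ a b A, A ∈ Sp E (p * a) (p * b) → p⁻¹ • A ∈ Sp E a b := by
    rintro p hp a b A ⟨h1, h2, h3⟩
    refine ⟨hinv2 p hp A h1, ?_, ?_⟩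
    · rw [Set.mem_smul_set_iff_inv_smul_mem, inv_inv]; exact h2
    · rw [Set.mem_smul_set_iff_inv_smul_mem, inv_inv]; exact h3
  have hTfin : T.Finite := by
    have : T ⊆ ⋃ j, ((⋃ A ∈ Sp E 1 (z j), {C | ∃ g ∈ H, C = g • A ∧ w C ≠ 0}) ∪
        (⋃ A ∈ Sp E (z j) 1, {C | ∃ g ∈ H, C = g • A ∧ w C ≠ 0})) := by
      rintro A ⟨hw, p, hp, j, h | h⟩
      · refine Set.mem_iUnion.2 ⟨j, Or.inl ?_⟩
        refine Set.mem_biUnion (hmv p hp 1 (z j) A (by simpa using h)) ?_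
        exact ⟨p, hp, by simp, hw⟩
      · refine Set.mem_iUnion.2 ⟨j, Or.inr ?_⟩
        refine Set.mem_biUnion (hmv p hp (z j) 1 A (by simpa using h)) ?_
        exact ⟨p, hp, by simp, hw⟩
    refine Set.Finite.subset (Set.finite_iUnion fun j => Set.Finite.union ?_ ?_) this
    · exact (hfin 1 (z j)).biUnion fun A hA => hwfin _ _ A hA
    · exact (hfin (z j) 1).biUnion fun A hA => hwfin _ _ A hA
  let TF := hTfin.toFinset
  have hTE : ∀ A ∈ T, A ∈ E := by
    rintro A ⟨_, p, _, j, h | h⟩ <;> exact h.1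
  let u1 : G → ℝ := fun x => (∑ A ∈ TF, w A * A.indicator (1 : G → ℝ) x) / 2
  refine ⟨u1, ?_, ?_, ?_⟩
  · intro t _
    refine (TF.finite_toSet.biUnion (t := fun A => support (dif t (A.indicator (1 : G → ℝ)))) fun A hA => ?_).subset ?_
    · exact hU A (hTE A (by simpa [TF] using hA)) t trivial
    · intro x hx
      by_contra hcon
      simp only [Set.mem_iUnion, not_exists, mem_support, not_not] at hcon
      apply hx
      simp only [dif, u1]
      rw [← sub_div, ← Finset.sum_sub_distrib, Finset.sum_eq_zero, zero_div]
      intro A hA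
      have := hcon A hA
      rw [← mul_sub]
      simp only [dif] at this
      rw [this, mul_zero]
  · intro j p hp
    have hq : p * z j ∈ H := H.mul_mem hp (hz j)
    have t1 := tr_tele hc hn f (p := p) (q := p * z j) (hfin p (p * z j)).toFinset
      (fun A => by rw [Set.Finite.mem_toFinset]; rfl)
    have t2 := tr_tele hc hn f (p := p * z j) (q := p) (hfin (p * z j) p).toFinset
      (fun A => by rw [Set.Finite.mem_toFinset]; rfl)
    have hf1 : f (vx E p) = u p := by simp only [f]; rw [hνx p hp]
    have hf2 : f (vx E (p * z j)) = u (p * z j) := by simp only [f]; rw [hνx _ hq]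
    rw [hf1, hf2] at t1 t2
    have t1' : ∑ A ∈ TF with (p ∈ A ∧ p * z j ∉ A), w A = u p - u (p * z j) := by
      rw [← t1]
      refine Finset.sum_subset_zero_on_sdiff ?_ ?_ (fun _ _ => rfl)
      · intro A hA
        rw [Finset.mem_filter] at hA
        rw [Set.Finite.mem_toFinset]
        exact ⟨hTE A (by simpa [TF] using hA.1), hA.2⟩
      · intro A hA
        rw [Finset.mem_sdiff, Set.Finite.mem_toFinset, Finset.mem_filter] at hA
        by_contra hw
        exact hA.2 ⟨by simp only [TF, Set.Finite.mem_toFinset]; exact ⟨hw, p, hp, j, Or.inl hA.1⟩, hA.1.2⟩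
    have t2' : ∑ A ∈ TF with (p * z j ∈ A ∧ p ∉ A), w A = u (p * z j) - u p := by
      rw [← t2]
      refine Finset.sum_subset_zero_on_sdiff ?_ ?_ (fun _ _ => rfl)
      · intro A hA
        rw [Finset.mem_filter] at hA
        rw [Set.Finite.mem_toFinset]
        exact ⟨hTE A (by simpa [TF] using hA.1), hA.2⟩
      · intro A hA
        rw [Finset.mem_sdiff, Set.Finite.mem_toFinset, Finset.mem_filter] at hA
        by_contra hw
        exact hA.2 ⟨by simp only [TF, Set.Finite.mem_toFinset]; exact ⟨hw, p, hp, j, Or.inr hA.1⟩, hA.1.2⟩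
    rw [Finset.sum_filter] at t1' t2'
    have : ∀ A ∈ TF, w A * A.indicator (1 : G → ℝ) (p * z j) - w A * A.indicator (1 : G → ℝ) p =
        (if p * z j ∈ A ∧ p ∉ A then w A else 0) - (if p ∈ A ∧ p * z j ∉ A then w A else 0) := by
      intro A _
      by_cases a1 : p ∈ A <;> by_cases a2 : p * z j ∈ A <;> simp [a1, a2]
    simp only [dif, u1]
    rw [← sub_div, ← Finset.sum_sub_distrib, Finset.sum_congr rfl this, Finset.sum_sub_distrib,
      t1', t2']
    ring
  · intro j x hx
    simp only [dif, u1]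
    rw [← sub_div, ← Finset.sum_sub_distrib, Finset.sum_eq_zero, zero_div]
    intro A hA
    have hAE := hTE A (by simpa [TF] using hA)
    have a1 : x ∈ A → x * z j ∈ A := by
      intro h; by_contra h'
      exact hx ((hH x).2 (hfix A hAE (z j) ((hH _).1 (hz j)) x h h'))
    have a2 : x * z j ∈ A → x ∈ A := by
      intro h; by_contra h'
      have := (hH _).2 (hfix A hAE (z j)⁻¹ ((hH _).1 (H.inv_mem (hz j))) (x * z j) h (by simpa using h'))
      exact hx ((H.mul_mem_cancel_right (hz j)).1 this)
    by_cases b : x ∈ A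
    · simp [b, a1 b]
    · have b2 : x * z j ∉ A := fun h => b (a2 h)
      simp [b, b2]

end propA
end S8

namespace S8
open Function
section hilb
open ContinuousLinearMap Filter
variable {E F : Type*} [NormedAddCommGroup E] [InnerProductSpace ℝ E] [CompleteSpace E]
  [NormedAddCommGroup F] [InnerProductSpace ℝ F] [CompleteSpace F]

noncomputable def SS (A : E →L[ℝ] F) (c : ℝ) : E →L[ℝ] E := 1 - c • (adjoint A ∘L A)

theorem SS_apply (A : E →L[ℝ] F) (c : ℝ) (d : E) : SS A c d = d - c • adjoint A (A d) := rfl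

theorem SS_norm (A : E →L[ℝ] F) {c : ℝ} (hc : 0 < c) (hcA : c * ‖A‖ ^ 2 ≤ 1) (d : E) :
    ‖SS A c d‖ ^ 2 ≤ ‖d‖ ^ 2 - c * ‖A d‖ ^ 2 := by
  rw [SS_apply, norm_sub_sq_real, inner_smul_right, adjoint_inner_right, real_inner_self_eq_norm_sq,
    norm_smul, Real.norm_of_nonneg hc.le]
  have h1 : ‖adjoint A (A d)‖ ≤ ‖A‖ * ‖A d‖ := by
    have := (adjoint A).le_opNorm (A d)
    rwa [LinearIsometryEquiv.norm_map] at this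
  have h2 : ‖adjoint A (A d)‖ ^ 2 ≤ (‖A‖ * ‖A d‖) ^ 2 := by gcongr
  have h3 : (c * ‖adjoint A (A d)‖) ^ 2 ≤ c * ‖A d‖ ^ 2 := by
    calc (c * ‖adjoint A (A d)‖) ^ 2 = c * (c * ‖adjoint A (A d)‖ ^ 2) := by ring
      _ ≤ c * (c * (‖A‖ * ‖A d‖) ^ 2) := by gcongr
      _ = c * ((c * ‖A‖ ^ 2) * ‖A d‖ ^ 2) := by ring
      _ ≤ c * (1 * ‖A d‖ ^ 2) := by gcongr
      _ = _ := by ring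
  linarith

theorem SS_inner (A : E →L[ℝ] F) (c : ℝ) (x y : E) : inner ℝ (SS A c x) y = inner ℝ x (SS A c y) := by
  simp only [SS_apply, inner_sub_left, inner_sub_right, inner_smul_left, inner_smul_right,
    adjoint_inner_left, adjoint_inner_right]
  simp

theorem SS_inner_iter (A : E →L[ℝ] F) (c : ℝ) (k : ℕ) (x y : E) :
    inner ℝ ((SS A c)^[k] x) y = inner ℝ x ((SS A c)^[k] y) := by
  induction k generalizing x y with
  | zero => rfl
  | succ k ih => rw [iterate_succ_apply', SS_inner, ih, iterate_succ_apply]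

theorem SS_comm (A : E →L[ℝ] F) (c : ℝ) (k : ℕ) (x : F) :
    A ((SS A c)^[k] (adjoint A x)) = (SS (adjoint A) c)^[k] (A (adjoint A x)) := by
  have : ∀ d, A (SS A c d) = SS (adjoint A) c (A d) := by
    intro d; simp [SS_apply]
  generalize adjoint A x = d
  induction k generalizing d with
  | zero => rfl
  | succ k ih => rw [iterate_succ_apply, ih, this, iterate_succ_apply]

theorem hilb_rank (A : E →L[ℝ] F) {J I : Type*} [Fintype J] [Fintype I] (e : J → E) (f : I → F)
    (he : ∀ j, ‖e j‖ = 1) (hf : ∀ i, ‖f i‖ = 1) (hJI : Fintype.card I + 1 ≤ Fintype.card J)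
    (htr : ∀ (c : ℝ) (k : ℕ), ∑ j, inner ℝ (e j) (adjoint A (A ((SS A c)^[k] (e j)))) =
      ∑ i, inner ℝ (f i) (A ((SS A c)^[k] (adjoint A (f i)))))
    (R : Submodule ℝ E) [R.HasOrthogonalProjection] (hR : ∀ d, A d = 0 → d ∈ R) :
    1 ≤ ∑ j, ‖R.starProjection (e j)‖ ^ 2 := by
  set c : ℝ := 1 / (‖A‖ ^ 2 + 1) with hcdef
  have hpos : 0 < ‖A‖ ^ 2 + 1 := by positivity
  have hc : 0 < c := by positivity
  have hcA : c * ‖A‖ ^ 2 ≤ 1 := by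
    rw [hcdef, div_mul_eq_mul_div, one_mul, div_le_one hpos]; linarith
  set S := SS A c
  set S' := SS (adjoint A) c
  have h1 : ∀ k : ℕ, ∑ j, inner ℝ (e j) (S^[k] (e j)) =
      (Fintype.card J - Fintype.card I : ℝ) + ∑ i, inner ℝ (f i) (S'^[k] (f i)) := by
    intro k
    induction k with
    | zero => simp [real_inner_self_eq_norm_sq, he, hf]
    | succ k ih =>
      have a1 : ∀ j, inner ℝ (e j) (S^[k+1] (e j)) = inner ℝ (e j) (S^[k] (e j)) -
          c * inner ℝ (e j) (adjoint A (A (S^[k] (e j)))) := by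
        intro j
        rw [iterate_succ_apply', SS_apply, inner_sub_right, inner_smul_right]
      have a2 : ∀ i, inner ℝ (f i) (S'^[k+1] (f i)) = inner ℝ (f i) (S'^[k] (f i)) -
          c * inner ℝ (f i) (A (S^[k] (adjoint A (f i)))) := by
        intro i
        have hlin : ∀ x y, S'^[k] (x - y) = S'^[k] x - S'^[k] y := fun x y => by
          rw [← FunLike.coe_pow_eq_iterate, map_sub]
        have hsm : ∀ x, S'^[k] (c • x) = c • S'^[k] x := fun x => by
          rw [← FunLike.coe_pow_eq_iterate, map_smul]
        rw [iterate_succ_apply, SS_apply, hlin, hsm, inner_sub_right, inner_smul_right, SS_comm,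
          adjoint_adjoint]
      simp only [a1, a2, Finset.sum_sub_distrib, ← Finset.mul_sum]
      rw [htr c k, ih]; ring
  have h2 : ∀ k : ℕ, 1 ≤ ∑ j, inner ℝ (e j) (S^[2 * k] (e j)) := by
    intro k
    rw [h1]
    have : 0 ≤ ∑ i, inner ℝ (f i) (S'^[2 * k] (f i)) := by
      refine Finset.sum_nonneg fun i _ => ?_
      rw [two_mul, iterate_add_apply, ← SS_inner_iter]
      exact real_inner_self_nonneg
    have h3 : (Fintype.card I : ℝ) + 1 ≤ Fintype.card J := by exact_mod_cast hJI
    linarith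
  let T : E →L[ℝ] E := S ∘L S
  have hS : ∀ d, ‖S d‖ ≤ ‖d‖ := by
    intro d
    have := SS_norm A hc hcA d
    have h4 : 0 ≤ c * ‖A d‖ ^ 2 := by positivity
    exact le_of_sq_le_sq (by linarith) (norm_nonneg _)
  have hT : ‖T‖ ≤ 1 := by
    refine ContinuousLinearMap.opNorm_le_bound _ zero_le_one fun d => ?_
    rw [one_mul]; exact (hS _).trans (hS d)
  have hfix : ∀ d, T d = d → A d = 0 := by
    intro d hd
    have h5 := SS_norm A hc hcA d
    have h6 : ‖d‖ ≤ ‖S d‖ := by conv_lhs => rw [← hd]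
                                exact hS _
    have h7 : ‖d‖ ^ 2 ≤ ‖S d‖ ^ 2 := by gcongr
    have h8 : c * ‖A d‖ ^ 2 ≤ 0 := by linarith
    have h9 : ‖A d‖ ^ 2 ≤ 0 := by
      by_contra h; push Not at h; nlinarith [mul_pos hc h]
    have : ‖A d‖ = 0 := by nlinarith [norm_nonneg (A d)]
    simpa using this
  have hTk : ∀ k d, T^[k] d = S^[2 * k] d := by
    intro k d
    rw [iterate_mul]; rfl
  set K := ((T : E →ₗ[ℝ] E).eqLocus ((1 : E →L[ℝ] E) : E →ₗ[ℝ] E)) with hK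
  have hconv := fun j => T.tendsto_birkhoffAverage_orthogonalProjection hT (e j)
  have hconv2 : Tendsto (fun N : ℕ => ∑ j, inner ℝ (e j) (birkhoffAverage ℝ T id N (e j))) atTop
      (nhds (∑ j, inner ℝ (e j) (K.orthogonalProjectionOnto (e j) : E))) :=
    tendsto_finsetSum _ fun j _ => (tendsto_const_nhds.inner (hconv j))
  have hlow : ∀ᶠ N : ℕ in atTop, 1 ≤ ∑ j, inner ℝ (e j) (birkhoffAverage ℝ T id N (e j)) := by
    filter_upwards [eventually_gt_atTop 0] with N hN
    simp only [birkhoffAverage, birkhoffSum, inner_smul_right, inner_sum, id]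
    rw [← Finset.mul_sum, Finset.sum_comm]
    have : (N : ℝ) ≤ ∑ k ∈ Finset.range N, ∑ j, inner ℝ (e j) (T^[k] (e j)) := by
      calc (N : ℝ) = ∑ k ∈ Finset.range N, (1 : ℝ) := by simp
        _ ≤ _ := Finset.sum_le_sum fun k _ => by simp only [hTk]; exact h2 k
    have hN' : (0 : ℝ) < N := by exact_mod_cast hN
    rw [inv_mul_eq_div, le_div_iff₀ hN', one_mul]
    exact this
  have hge := ge_of_tendsto hconv2 hlow
  refine hge.trans (Finset.sum_le_sum fun j _ => ?_)
  set k := (K.orthogonalProjectionOnto (e j) : E)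
  have hkK : k ∈ K := Submodule.coe_mem _
  have hkR : k ∈ R := hR _ (hfix _ hkK)
  have e1 : inner ℝ (e j) k = inner ℝ (R.starProjection (e j)) k := by
    rw [Submodule.inner_starProjection_left_eq_right, Submodule.starProjection_eq_self_iff.2 hkR]
  have e2 : inner ℝ (e j) k = ‖k‖ ^ 2 := by
    rw [← real_inner_self_eq_norm_sq]
    have : k = K.starProjection (e j) := rfl
    have h3 : K.starProjection k = k := Submodule.starProjection_eq_self_iff.2 hkK
    conv_rhs => rw [this, Submodule.inner_starProjection_left_eq_right, ← this, h3]
  have e3 : inner ℝ (R.starProjection (e j)) k ≤ ‖R.starProjection (e j)‖ * ‖k‖ := real_inner_le_norm _ _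
  nlinarith [sq_nonneg (‖R.starProjection (e j)‖ - ‖k‖), norm_nonneg k]

theorem hilb_limit {J : Type*} [Fintype J] (e : J → E) (R : ℕ → Submodule ℝ E)
    [∀ i, (R i).HasOrthogonalProjection] (hanti : Antitone R)
    (h : ∀ i, 1 ≤ ∑ j, ‖(R i).starProjection (e j)‖ ^ 2) :
    ∃ j, ∃ d, (∀ i, d ∈ R i) ∧ inner ℝ (e j) d ≠ 0 := by
  let U : ℕ → Submodule ℝ E := fun i => (R i)ᗮ
  have hU : Monotone U := fun a b hab => Submodule.orthogonal_le (hanti hab)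
  set Q := (⨆ i, U i).topologicalClosure
  have hQ := fun j => Submodule.starProjection_tendsto_closure_iSup U hU (e j)
  have hlim : Tendsto (fun i => ∑ j, ‖(R i).starProjection (e j)‖ ^ 2) atTop
      (nhds (∑ j, ‖e j - Q.starProjection (e j)‖ ^ 2)) := by
    refine tendsto_finsetSum _ fun j _ => ?_
    have := ((tendsto_const_nhds (x := e j)).sub (hQ j)).norm.pow 2
    refine this.congr fun i => ?_
    congr 2
    have := Submodule.starProjection_add_starProjection_orthogonal (K := R i) (e j)
    exact sub_eq_of_eq_add this.symm
  have h1 := ge_of_tendsto hlim (Eventually.of_forall h)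
  have h2 : ∃ j, e j - Q.starProjection (e j) ≠ 0 := by
    by_contra hcon
    push Not at hcon
    rw [Finset.sum_eq_zero (fun j _ => by rw [hcon j]; simp)] at h1
    norm_num at h1
  obtain ⟨j, hj⟩ := h2
  set d := e j - Q.starProjection (e j)
  have hd : d ∈ Qᗮ := Submodule.sub_starProjection_mem_orthogonal _
  refine ⟨j, d, fun i => ?_, ?_⟩
  · have h3 : d ∈ (U i)ᗮ := Submodule.orthogonal_le
      ((le_iSup U i).trans (Submodule.le_topologicalClosure _)) hd
    rwa [Submodule.orthogonal_orthogonal] at h3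
  · have h4 : inner ℝ (e j) d = inner ℝ d d := by
      have : e j = d + Q.starProjection (e j) := by simp [d]
      have h5 : inner ℝ (Q.starProjection (e j)) d = 0 :=
        Submodule.inner_right_of_mem_orthogonal (Submodule.starProjection_apply_mem _ _) hd
      conv_lhs => rw [this, inner_add_left, h5, add_zero]
    rw [h4]
    simpa using hj

end hilb
end S8

namespace S8
open Function
section ell
open ContinuousLinearMap Filter

def L2 (α : Type*) : Type _ := lp (fun _ : α => ℝ) 2

variable {α β γ : Type*}

noncomputable instance : NormedAddCommGroup (L2 α) :=
  inferInstanceAs (NormedAddCommGroup (lp (fun _ : α => ℝ) 2))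
noncomputable instance : InnerProductSpace ℝ (L2 α) :=
  inferInstanceAs (InnerProductSpace ℝ (lp (fun _ : α => ℝ) 2))
instance : CompleteSpace (L2 α) :=
  inferInstanceAs (CompleteSpace (lp (fun _ : α => ℝ) 2))

def L2.toFun (d : L2 α) : α → ℝ := Subtype.val d

instance : CoeFun (L2 α) (fun _ => α → ℝ) := ⟨L2.toFun⟩

theorem L2.ext {a b : L2 α} (h : ∀ x, a x = b x) : a = b := Subtype.ext (funext h)
@[simp] theorem L2.add_apply (a b : L2 α) (x : α) : (a + b) x = a x + b x := rfl
@[simp] theorem L2.sub_apply (a b : L2 α) (x : α) : (a - b) x = a x - b x := rfl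
@[simp] theorem L2.neg_apply (a : L2 α) (x : α) : (-a) x = - a x := rfl
@[simp] theorem L2.zero_apply (x : α) : (0 : L2 α) x = 0 := rfl
@[simp] theorem L2.smul_apply (c : ℝ) (a : L2 α) (x : α) : (c • a) x = c * a x := rfl

theorem l2_hasSum (a b : L2 α) : HasSum (fun x => b x * a x) (inner ℝ a b) :=
  lp.hasSum_inner (𝕜 := ℝ) (G := fun _ : α => ℝ) a b

theorem l2_inner (a b : L2 α) : inner ℝ a b = ∑' x, b x * a x := (l2_hasSum a b).tsum_eq.symm

theorem l2_summable (a b : L2 α) : Summable fun x => b x * a x := (l2_hasSum a b).summable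

theorem l2_normsq (a : L2 α) : HasSum (fun x => a x ^ 2) (‖a‖ ^ 2) := by
  have := l2_hasSum a a
  rw [real_inner_self_eq_norm_sq] at this
  simpa only [sq] using this

theorem l2_mem {f : α → ℝ} : Memℓp f 2 ↔ Summable fun x => f x ^ 2 := by
  rw [memℓp_gen_iff (by norm_num)]
  simp

def mkL (f : α → ℝ) (hf : Summable fun x => f x ^ 2) : L2 α := ⟨f, l2_mem.2 hf⟩

@[simp] theorem mkL_apply (f : α → ℝ) (hf : Summable fun x => f x ^ 2) (a : α) : mkL f hf a = f a := rfl

noncomputable def cmp (f : α → β) (hf : Injective f) : L2 β →L[ℝ] L2 α :=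
  LinearMap.mkContinuous
    { toFun := fun d => mkL (fun a => d (f a)) ((l2_normsq d).summable.comp_injective hf)
      map_add' := fun x y => rfl
      map_smul' := fun c x => rfl } 1 (fun d => by
        rw [one_mul]
        refine le_of_sq_le_sq ?_ (norm_nonneg _)
        rw [← (l2_normsq _).tsum_eq, ← (l2_normsq d).tsum_eq]
        exact Summable.tsum_le_tsum_of_inj f hf (fun _ _ => sq_nonneg _)
          (fun _ => le_rfl) (l2_normsq _).summable (l2_normsq d).summable)

@[simp] theorem cmp_apply (f : α → β) (hf : Injective f) (d : L2 β) (a : α) : cmp f hf d a = d (f a) := rfl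

noncomputable def dl (a : α) : L2 α := mkL (fun b => by classical exact if b = a then 1 else 0) (by
  refine summable_of_hasFiniteSupport ((Set.finite_singleton a).subset fun x hx => ?_)
  by_contra h
  have : x ≠ a := h
  simp [this] at hx)

theorem dl_self (a : α) : dl a a = 1 := by
  simp [dl]

theorem dl_ne {a b : α} (h : b ≠ a) : dl a b = 0 := by
  simp [dl, h]

theorem inner_dl (a : α) (d : L2 α) : inner ℝ (dl a) d = d a := by
  rw [l2_inner, tsum_eq_single a, dl_self, mul_one]
  intro b hb
  rw [dl_ne hb, mul_zero]

theorem norm_dl (a : α) : ‖dl a‖ = 1 := by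
  have := real_inner_self_eq_norm_sq (dl a)
  rw [inner_dl, dl_self] at this
  nlinarith [norm_nonneg (dl a)]

theorem cmp_dl (f : α → β) (hf : Injective f) (a : α) : cmp f hf (dl (f a)) = dl a := by
  refine L2.ext fun b => ?_
  rw [cmp_apply]
  by_cases h : b = a
  · rw [h, dl_self, dl_self]
  · rw [dl_ne h, dl_ne (fun h' => h (hf h'))]

theorem cmp_adj (f : α → β) (hf : Injective f) (d : L2 α) (a : α) : adjoint (cmp f hf) d (f a) = d a := by
  rw [← inner_dl, adjoint_inner_right, cmp_dl, inner_dl]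

theorem cmp_adj' (f : α → β) (hf : Injective f) (d : L2 α) (b : β) (hb : ∀ a, f a ≠ b) :
    adjoint (cmp f hf) d b = 0 := by
  rw [← inner_dl, adjoint_inner_right]
  have : cmp f hf (dl b) = 0 := by
    refine L2.ext fun a => ?_; rw [cmp_apply, dl_ne (hb a)]; rfl
  rw [this, inner_zero_left]

noncomputable def toL (f : α → ℝ) (hf : (support f).Finite) : L2 α := mkL f (by
  refine summable_of_hasFiniteSupport (hf.subset fun x hx h => hx ?_)
  simp only [h]; norm_num)

@[simp] theorem toL_apply (f : α → ℝ) (hf : (support f).Finite) (a : α) : toL f hf a = f a := rfl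

theorem L2.sum_apply {J : Type*} (S : Finset J) (f : J → L2 α) (x : α) : (∑ j ∈ S, f j) x = ∑ j ∈ S, f j x := by
  classical
  induction S using Finset.induction_on with
  | empty => simp
  | insert a S ha ih => rw [Finset.sum_insert ha, Finset.sum_insert ha, L2.add_apply, ih]

end ell

section rel
open ContinuousLinearMap Filter
variable {G : Type*} [Group G] {ι κ : Type*}

def Rset (y : ι → G) (M : Subgroup G) : Set (L2 (ι × G)) :=
  {v | ∃ u ∈ UU M, ∀ p : ι × G, v p = dif (y p.1) u p.2}

noncomputable def Rsub (y : ι → G) (M : Subgroup G) : Submodule ℝ (L2 (ι × G)) := (Submodule.span ℝ (Rset y M))ᗮ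

noncomputable instance (y : ι → G) (M : Subgroup G) : (Rsub y M).HasOrthogonalProjection := by
  unfold Rsub; infer_instance

theorem dif_fin [Finite ι] {y : ι → G} {M : Subgroup G} (hy : ∀ j, y j ∈ M) {u : G → ℝ} (hu : u ∈ UU M) :
    (support fun p : ι × G => dif (y p.1) u p.2).Finite := by
  refine (Set.finite_iUnion fun j => (hu (y j) (hy j)).image fun x => (j, x)).subset ?_
  rintro ⟨j, x⟩ hx
  exact Set.mem_iUnion.2 ⟨j, x, hx, rfl⟩

theorem mem_Rsub [Finite ι] {y : ι → G} {M : Subgroup G} (hy : ∀ j, y j ∈ M) (d : L2 (ι × G)) :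
    d ∈ Rsub y M ↔ Rel y M d := by
  rw [Rsub, Submodule.mem_orthogonal]
  constructor
  · intro h u hu
    have := h (toL _ (dif_fin hy hu)) (Submodule.subset_span ⟨u, hu, fun p => rfl⟩)
    rw [l2_inner] at this
    exact this
  · intro h v hv
    induction hv using Submodule.span_induction with
    | mem v hv =>
      obtain ⟨u, hu, huv⟩ := hv
      rw [l2_inner]
      simp only [huv]
      exact h u hu
    | zero => simp
    | add a b _ _ ha hb => rw [inner_add_left, ha, hb, add_zero]
    | smul c a _ ha => rw [inner_smul_left, ha, mul_zero]

/-- left translation -/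
noncomputable def lam (ι : Type*) (g : G) : L2 (ι × G) →L[ℝ] L2 (ι × G) :=
  cmp (fun p => (p.1, g * p.2)) (fun p q h => by
    simp only [Prod.mk.injEq, mul_right_inj] at h; exact Prod.ext h.1 h.2)

@[simp] theorem lam_apply (g : G) (d : L2 (ι × G)) (p : ι × G) : lam ι g d p = d (p.1, g * p.2) := rfl

theorem lam_dl (g : G) (i : ι) (x : G) : lam ι g (dl (i, g * x)) = dl (i, x) := by
  exact cmp_dl (fun p : ι × G => (p.1, g * p.2)) _ (i, x)

theorem lam_adj (g : G) : adjoint (lam ι g) = lam ι g⁻¹ := by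
  refine ContinuousLinearMap.ext fun d => L2.ext fun ⟨i, x⟩ => ?_
  rw [lam_apply]
  have := cmp_adj (fun p : ι × G => (p.1, g * p.2)) (fun p q h => by
    simp only [Prod.mk.injEq, mul_right_inj] at h; exact Prod.ext h.1 h.2) d (i, g⁻¹ * x)
  simp only [mul_inv_cancel_left] at this
  exact this

def Eqv (X : L2 (ι × G) →L[ℝ] L2 (κ × G)) : Prop := ∀ g d, X (lam ι g d) = lam κ g (X d)

theorem Eqv.adj {X : L2 (ι × G) →L[ℝ] L2 (κ × G)} (h : Eqv X) : Eqv (adjoint X) := by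
  intro g d
  refine ext_inner_left ℝ fun v => ?_
  have e1 : lam κ g = adjoint (lam κ g⁻¹) := by rw [lam_adj, inv_inv]
  have e2 : lam ι g = adjoint (lam ι g⁻¹) := by rw [lam_adj, inv_inv]
  rw [adjoint_inner_right, e1, e2, adjoint_inner_right, adjoint_inner_right, adjoint_inner_right, h]

theorem trace_gen [Fintype κ] (X : L2 (ι × G) →L[ℝ] L2 (κ × G))
      (Y : L2 (κ × G) →L[ℝ] L2 (ι × G)) (j : ι) :
      inner ℝ (dl (j, (1 : G))) (Y (X (dl (j, 1)))) =
        ∑ i, ∑' x, X (dl (j, 1)) (i, x) * Y (dl (i, x)) (j, 1) := by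
  have h1 : ∀ p, adjoint Y (dl (j, 1)) p = Y (dl p) (j, 1) := by
    intro p
    rw [← inner_dl, adjoint_inner_right, real_inner_comm, inner_dl]
  rw [← adjoint_inner_left, l2_inner]
  have hs := l2_summable (adjoint Y (dl (j, 1))) (X (dl (j, 1)))
  rw [hs.tsum_prod, tsum_fintype]
  simp only [h1]

theorem trace_comm [Fintype ι] [Fintype κ] (X : L2 (ι × G) →L[ℝ] L2 (κ × G)) (Y : L2 (κ × G) →L[ℝ] L2 (ι × G))
    (hX : Eqv X) (hY : Eqv Y) :
    ∑ j, inner ℝ (dl (j, (1 : G))) (Y (X (dl (j, 1)))) = ∑ i, inner ℝ (dl (i, (1 : G))) (X (Y (dl (i, 1)))) := by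
  rw [Finset.sum_congr rfl fun j _ => trace_gen X Y j, Finset.sum_congr rfl fun i _ => trace_gen Y X i,
    Finset.sum_comm]
  refine Finset.sum_congr rfl fun i _ => Finset.sum_congr rfl fun j _ => ?_
  rw [← (Equiv.inv G).tsum_eq]
  refine tsum_congr fun x => ?_
  simp only [Equiv.inv_apply]
  have e1 : dl (i, x⁻¹) = lam κ x (dl (i, 1)) := by
    have := lam_dl x i x⁻¹
    rw [mul_inv_cancel] at this; exact this.symm
  have e2 : dl (j, x) = lam ι x⁻¹ (dl (j, 1)) := by
    have := lam_dl x⁻¹ j x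
    rw [inv_mul_cancel] at this; exact this.symm
  rw [e1, hY, lam_apply, e2, hX, lam_apply]
  simp only [mul_one]
  ring

theorem opB1 (s : κ → G) (m : G) (hm : m ∈ Subgroup.closure (Set.range s)) :
    ∃ B : L2 (κ × G) →L[ℝ] L2 G, (∀ g d x, B (lam κ g d) x = B d (g * x)) ∧
      ∀ (v : L2 (κ × G)) (u : G → ℝ), (∀ p, v p = dif (s p.1) u p.2) → ∀ x, B v x = dif m u x := by
  induction hm using Subgroup.closure_induction with
  | mem m hm =>
    obtain ⟨i, rfl⟩ := hm
    refine ⟨cmp (fun x => (i, x)) (fun a b h => (Prod.mk.inj h).2), fun g d x => ?_, fun v u hv x => ?_⟩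
    · rfl
    · exact hv (i, x)
  | one => exact ⟨0, fun g d x => by simp, fun v u hv x => by rw [dif_one]; rfl⟩
  | mul m n _ _ hm hn =>
    obtain ⟨B1, h1, h1'⟩ := hm
    obtain ⟨B2, h2, h2'⟩ := hn
    refine ⟨B1 + (cmp (fun x => x * m) (mul_left_injective m)) ∘L B2, fun g d x => ?_, fun v u hv x => ?_⟩
    · have : ∀ d x, (B1 + (cmp (fun x => x * m) (mul_left_injective m)) ∘L B2) d x = B1 d x + B2 d (x * m) :=
        fun _ _ => rfl
      rw [this, this, h1, h2, mul_assoc]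
    · have : ∀ d x, (B1 + (cmp (fun x => x * m) (mul_left_injective m)) ∘L B2) d x = B1 d x + B2 d (x * m) :=
        fun _ _ => rfl
      rw [this, h1' v u hv, h2' v u hv]
      simp only [dif]
      rw [mul_assoc]; ring
  | inv m _ hm =>
    obtain ⟨B1, h1, h1'⟩ := hm
    have : ∀ d x, (- ((cmp (fun x => x * m⁻¹) (mul_left_injective m⁻¹)) ∘L B1)) d x = - B1 d (x * m⁻¹) :=
        fun _ _ => rfl
    refine ⟨- ((cmp (fun x => x * m⁻¹) (mul_left_injective m⁻¹)) ∘L B1), fun g d x => ?_, fun v u hv x => ?_⟩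
    · rw [this, this, h1, mul_assoc]
    · rw [this, h1' v u hv, dif_inv]

theorem opB [Fintype ι] (s : κ → G) (y : ι → G) (hy : ∀ j, y j ∈ Subgroup.closure (Set.range s)) :
    ∃ B : L2 (κ × G) →L[ℝ] L2 (ι × G), Eqv B ∧
      ∀ (v : L2 (κ × G)) (u : G → ℝ), (∀ p, v p = dif (s p.1) u p.2) → ∀ p, B v p = dif (y p.1) u p.2 := by
  choose B hB1 hB2 using fun j => opB1 s (y j) (hy j)
  have hinj : ∀ j : ι, Injective (fun x : G => (j, x)) := fun j a b h => (Prod.mk.inj h).2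
  let C : L2 (κ × G) →L[ℝ] L2 (ι × G) := ∑ j, adjoint (cmp (fun x : G => (j, x)) (hinj j)) ∘L B j
  have hC : ∀ d j x, C d (j, x) = B j d x := by
    intro d j x
    simp only [C, ContinuousLinearMap.sum_apply, ContinuousLinearMap.comp_apply]
    rw [L2.sum_apply, Finset.sum_eq_single j]
    · exact cmp_adj (fun x : G => (j, x)) (hinj j) _ x
    · intro j' _ hj'
      refine cmp_adj' _ _ _ _ fun a h => hj' (Prod.mk.inj h).1
    · intro h; exact absurd (Finset.mem_univ _) h
  refine ⟨C, fun g d => ?_, fun v u hv p => ?_⟩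
  · refine L2.ext fun ⟨j, x⟩ => ?_
    rw [hC, lam_apply, hC, hB1]
  · obtain ⟨j, x⟩ := p
    rw [hC, hB2 j v u hv]

theorem rel_adj [Finite ι] [Finite κ] {s : κ → G} {y : ι → G} (B : L2 (κ × G) →L[ℝ] L2 (ι × G))
    (hB : ∀ (v : L2 (κ × G)) (u : G → ℝ), (∀ p, v p = dif (s p.1) u p.2) → ∀ p, B v p = dif (y p.1) u p.2)
    {M : Subgroup G} (hs : ∀ i, s i ∈ M) (d : L2 (ι × G)) :
    Rel s M (adjoint B d) ↔ Rel y M d := by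
  have key : ∀ u ∈ UU M, ∑' p : κ × G, adjoint B d p * dif (s p.1) u p.2 =
      ∑' p : ι × G, d p * dif (y p.1) u p.2 := by
    intro u hu
    have h1 := l2_inner (toL _ (dif_fin hs hu)) (adjoint B d)
    rw [adjoint_inner_right, l2_inner] at h1
    simp only [toL_apply] at h1
    rw [← h1]
    refine tsum_congr fun p => ?_
    rw [hB _ u (fun p => rfl)]
  exact ⟨fun h u hu => by rw [← key u hu]; exact h u hu, fun h u hu => by rw [key u hu]; exact h u hu⟩

theorem Eqv_iter {A : L2 (ι × G) →L[ℝ] L2 (κ × G)} (hA : Eqv A) (c : ℝ) (k : ℕ) (g : G) (d : L2 (ι × G)) :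
    (SS A c)^[k] (lam ι g d) = lam ι g ((SS A c)^[k] d) := by
  induction k with
  | zero => rfl
  | succ k ih =>
    rw [iterate_succ_apply', ih, iterate_succ_apply', SS_apply, SS_apply, hA, hA.adj, map_sub, map_smul]

theorem rank_bound [Fintype ι] [Fintype κ] (s : κ → G) (y : ι → G)
    (hy : ∀ j, y j ∈ Subgroup.closure (Set.range s)) (hcard : Fintype.card κ + 1 ≤ Fintype.card ι) :
    1 ≤ ∑ j, ‖(Rsub y (Subgroup.closure (Set.range s))).starProjection (dl (j, (1 : G)))‖ ^ 2 := by
  obtain ⟨B, hB, hB'⟩ := opB s y hy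
  refine hilb_rank (adjoint B) (fun j => dl (j, (1 : G))) (fun i : κ => dl (i, (1 : G)))
    (fun j => norm_dl _) (fun i => norm_dl _) hcard ?_ _ ?_
  · intro c k
    rw [adjoint_adjoint]
    have hS : Eqv (adjoint B ∘L (SS (adjoint B) c) ^ k) := by
      intro g d
      rw [ContinuousLinearMap.comp_apply, ContinuousLinearMap.comp_apply, FunLike.coe_pow_eq_iterate, Eqv_iter hB.adj, hB.adj]
    have := trace_comm (adjoint B ∘L (SS (adjoint B) c) ^ k) B hS hB
    simpa only [ContinuousLinearMap.comp_apply, FunLike.coe_pow_eq_iterate] using this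
  · intro d hd
    rw [mem_Rsub hy, ← rel_adj B hB' (fun i => Subgroup.subset_closure (Set.mem_range_self i)), hd]
    intro u hu
    simp

end rel
end S8

namespace S8
open Function
section propX
open ContinuousLinearMap

theorem exists_FB.{u} {Λ : Type u} [Group Λ] [IsFreeGroup Λ] (M : Subgroup Λ) :
    ∃ (κ : Type u) (s : κ → Λ), FB s M :=
  ⟨IsFreeGroup.Generators M, fun i => (IsFreeGroup.basis M i : Λ), IsFreeGroup.basis M, fun _ => rfl⟩

theorem tf_of_free {Λ : Type*} [Group Λ] [IsFreeGroup Λ] : IsMulTorsionFree Λ :=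
  Function.Injective.isMulTorsionFree (IsFreeGroup.basis Λ).repr.toMonoidHom
    (IsFreeGroup.basis Λ).repr.injective

variable {G : Type*} [Group G]

theorem fin_supp {κ : Type*} (s : κ → G) (m : G) (hm : m ∈ Subgroup.closure (Set.range s)) :
    ∃ B : Set κ, B.Finite ∧ m ∈ Subgroup.closure (s '' B) := by
  induction hm using Subgroup.closure_induction with
  | mem m hm =>
    obtain ⟨i, rfl⟩ := hm
    exact ⟨{i}, Set.finite_singleton i, Subgroup.subset_closure ⟨i, rfl, rfl⟩⟩
  | one => exact ⟨∅, Set.finite_empty, Subgroup.one_mem _⟩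
  | mul m n _ _ hm hn =>
    obtain ⟨B1, h1, h1'⟩ := hm
    obtain ⟨B2, h2, h2'⟩ := hn
    refine ⟨B1 ∪ B2, h1.union h2, Subgroup.mul_mem _ ?_ ?_⟩
    · exact Subgroup.closure_mono (Set.image_mono Set.subset_union_left) h1'
    · exact Subgroup.closure_mono (Set.image_mono Set.subset_union_right) h2'
  | inv m _ hm =>
    obtain ⟨B1, h1, h1'⟩ := hm
    exact ⟨B1, h1, Subgroup.inv_mem _ h1'⟩

theorem fin_supp' {κ : Type*} (s : κ → G) {ι : Type*} [Finite ι] (y : ι → G)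
    (hy : ∀ j, y j ∈ Subgroup.closure (Set.range s)) :
    ∃ B : Set κ, B.Finite ∧ ∀ j, y j ∈ Subgroup.closure (s '' B) := by
  choose B h1 h2 using fun j => fin_supp s (y j) (hy j)
  refine ⟨⋃ j, B j, Set.finite_iUnion h1, fun j => ?_⟩
  exact Subgroup.closure_mono (Set.image_mono (Set.subset_iUnion B j)) (h2 j)

theorem FB.finite {κ : Type*} {s : κ → G} {M : Subgroup G} (hs : FB s M) {T : Set G} (hT : T.Finite)
    (hM : Subgroup.closure T = M) : Finite κ := by
  classical
  have := hT.to_subtype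
  obtain ⟨B, hB, hB'⟩ := fin_supp' s (fun t : T => (t : G)) (fun t => by
    rw [hs.closure, ← hM]; exact Subgroup.subset_closure t.2)
  have hle : M ≤ Subgroup.closure (s '' B) := by
    rw [← hM, Subgroup.closure_le]; exact fun t ht => hB' ⟨t, ht⟩
  obtain ⟨b, hb⟩ := hs
  have : B = Set.univ := by
    by_contra hne
    obtain ⟨k, hk⟩ := (Set.ne_univ_iff_exists_notMem B).1 hne
    let f : M →* Multiplicative ℤ := b.lift fun i => if i = k then Multiplicative.ofAdd 1 else 1
    have hf : ∀ i, f (b i) = if i = k then Multiplicative.ofAdd 1 else 1 := fun i => by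
      simp [f]
    have h1 : M ≤ (f.ker).map M.subtype := by
      refine hle.trans ?_
      rw [Subgroup.closure_le]
      rintro _ ⟨i, hi, rfl⟩
      refine ⟨b i, ?_, hb i⟩
      have : i ≠ k := fun h => hk (h ▸ hi)
      rw [SetLike.mem_coe, MonoidHom.mem_ker, hf, if_neg this]
    obtain ⟨x, hx, hx'⟩ := h1 (b k).2
    have : x = b k := Subtype.ext hx'
    rw [SetLike.mem_coe, MonoidHom.mem_ker, this, hf, if_pos rfl] at hx
    exact absurd hx (by decide)
  rw [this] at hB
  exact Set.finite_univ_iff.1 hB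

theorem propX_core [IsFreeGroup G] (φ : G ≃* G) (H : Subgroup G) (hH : ∀ x, x ∈ H ↔ φ x = x)
    {κ : Type*} {s' : κ → G} (hs' : FB s' H) {ι : Type*} [Finite ι] (e : ι → κ) (he : Injective e)
    (L : Subgroup G) (hL : ∀ x ∈ L, φ x ∈ L) (m : ℕ) (hm0 : 0 < m) (hm : ∀ x ∈ L, (⇑φ)^[m] x = x)
    {T : Set G} (hT : T.Finite) (hTL : Subgroup.closure T = L) (hz : ∀ j, s' (e j) ∈ L)
    (p : ι × G → ℝ) (hp : Rel (s' ∘ e) L p) : p = 0 := by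
  classical
  ext ⟨j0, x0⟩
  simp only [Pi.zero_apply]
  have htf : IsMulTorsionFree L := tf_of_free
  obtain ⟨κ', t, ht⟩ := exists_FB (⊤ : Subgroup L)
  have hfin : Finite κ' := by
    refine ht.finite (T := Subtype.val ⁻¹' T) (hT.preimage Subtype.val_injective.injOn) ?_
    subst hTL
    exact Subgroup.closure_closure_coe_preimage
  let φ0 : L →* L := (φ.toMonoidHom.comp L.subtype).codRestrict L (fun x => hL x x.2)
  have hφ0 : ∀ x, (φ0 x : G) = φ x := fun x => rfl
  have hit : ∀ n x, ((⇑φ0)^[n] x : G) = (⇑φ)^[n] x := by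
    intro n x
    induction n with
    | zero => rfl
    | succ n ih => rw [iterate_succ_apply', iterate_succ_apply', hφ0, ih]
  have hitm : ∀ x, (⇑φ0)^[m] x = x := fun x => Subtype.ext (by rw [hit, hm x x.2])
  have hbij : Bijective φ0 := by
    constructor
    · intro x y h
      have : φ x = φ y := congrArg Subtype.val h
      exact Subtype.ext (φ.injective this)
    · intro y
      refine ⟨(⇑φ0)^[m-1] y, ?_⟩
      rw [← iterate_succ_apply' (⇑φ0)]
      rw [show (m - 1).succ = m by omega]
      exact hitm y
  let φ' : L ≃* L := MulEquiv.ofBijective φ0 hbij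
  obtain ⟨u, hu, hud⟩ := lemU' hs' (fun i x => if i = e j0 ∧ x = 1 then 1 else 0) (by
    intro i
    refine (Set.finite_singleton (1 : G)).subset fun x hx => ?_
    by_contra h
    have h' : x ≠ 1 := h
    simp [h'] at hx)
  let z' : ι → L := fun j => ⟨s' (e j), hz j⟩
  have hdu : ∀ (a : L) x, dif a (fun x : L => u x) x = dif (a : G) u x := fun a x => rfl
  obtain ⟨u', hu', h1, h2⟩ := propA ht φ' m hm0 hitm (H.subgroupOf L)
    (fun x => by
      rw [Subgroup.mem_subgroupOf, hH]
      exact ⟨fun h => Subtype.ext h, fun h => congrArg Subtype.val h⟩) z'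
    (fun j => by rw [Subgroup.mem_subgroupOf]; exact hs'.mem _) (fun x : L => u x) (by
      intro a ha
      rw [Subgroup.mem_subgroupOf] at ha
      exact (hu a ha).preimage Subtype.val_injective.injOn)
  have h3 : ∀ j (x : L), dif (z' j) u' x = if j = j0 ∧ x = 1 then 1 else 0 := by
    intro j x
    by_cases hx : x ∈ H.subgroupOf L
    · rw [h1 j x hx, hdu, hud]
      simp [he.eq_iff]
    · rw [h2 j x hx, if_neg]
      rintro ⟨_, rfl⟩
      exact hx (Subgroup.one_mem _)
  have h4 := lemT L L le_rfl (s' ∘ e) hz p hp x0 u' (by rwa [Subgroup.subgroupOf_self])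
  rw [tsum_eq_single (j0, 1)] at h4
  · have := h3 j0 1
    simp only [true_and, if_true] at this
    change p (j0, x0 * ((1 : L) : G)) * dif (z' j0) u' 1 = 0 at h4
    rw [this] at h4
    simpa using h4
  · rintro ⟨j, x⟩ hne
    change p (j, x0 * (x : G)) * dif (z' j) u' x = 0
    rw [h3, if_neg, mul_zero]
    rintro ⟨rfl, rfl⟩; exact hne rfl

theorem Rel.aut {ι : Type*} {z : ι → G} {d : ι × G → ℝ} (hd : Rel z ⊤ d) (φ : G ≃* G)
    (hz : ∀ j, φ (z j) = z j) : Rel z ⊤ (fun q => d (q.1, φ q.2)) := by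
  intro u hu
  have h1 : ∀ j x, dif (z j) (fun x => u (φ.symm x)) (φ x) = dif (z j) u x := by
    intro j x
    simp only [dif, map_mul, MulEquiv.symm_apply_apply]
    rw [show φ.symm (z j) = z j by rw [MulEquiv.symm_apply_eq, hz]]
  rw [← hd (fun x => u (φ.symm x))]
  · let e : ι × G ≃ ι × G := Equiv.prodCongr (Equiv.refl _) φ.toEquiv
    refine Eq.trans ?_ (e.tsum_eq (fun p : ι × G => d p * dif (z p.1) (fun x => u (φ.symm x)) p.2))
    refine tsum_congr fun q => ?_
    change _ = d (q.1, φ q.2) * dif (z q.1) (fun x => u (φ.symm x)) (φ q.2)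
    rw [h1]
  · intro m _
    refine ((hu (φ.symm m) trivial).image φ).subset fun x hx => ?_
    refine ⟨φ.symm x, ?_, by simp⟩
    intro h; apply hx
    rw [← h]; simp [dif]

theorem propX [IsFreeGroup G] (φ : G ≃* G) (H : Subgroup G) (hH : ∀ x, x ∈ H ↔ φ x = x)
    {κ : Type*} {s' : κ → G} (hs' : FB s' H) {ι : Type*} [Finite ι] (e : ι → κ) (he : Injective e)
    (d : L2 (ι × G)) (hd : Rel (s' ∘ e) ⊤ d) : d = 0 := by
  classical
  by_contra hd0
  have : ∃ q, d q ≠ 0 := by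
    by_contra h; push Not at h; exact hd0 (L2.ext h)
  obtain ⟨⟨j, x0⟩, hq⟩ := this
  set z : ι → G := s' ∘ e with hzdef
  have hzH : ∀ j, z j ∈ H := fun j => hs'.mem _
  have hzφ : ∀ j, φ (z j) = z j := fun j => (hH _).1 (hzH j)
  have hzφ' : ∀ j, φ.symm (z j) = z j := fun j => by rw [MulEquiv.symm_apply_eq, hzφ]
  have hztop : ∀ j, z j ∈ (⊤ : Subgroup G) := fun _ => trivial
  set R := Rsub z (⊤ : Subgroup G) with hR
  have hd1 : lam ι x0 d ∈ R := (mem_Rsub hztop _).2 (hd.trans_left x0)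
  set p := R.starProjection (dl (j, (1 : G))) with hpdef
  have hpR : p ∈ R := Submodule.starProjection_apply_mem _ _
  have hp0 : p ≠ 0 := by
    intro hp
    have h1 : inner ℝ (dl (j, (1 : G))) (lam ι x0 d) = inner ℝ p (lam ι x0 d) := by
      rw [hpdef, Submodule.inner_starProjection_left_eq_right, Submodule.starProjection_eq_self_iff.2 hd1]
    rw [hp, inner_zero_left, inner_dl, lam_apply] at h1
    simp only [mul_one] at h1
    exact hq h1
  have hinj : ∀ ψ : G ≃* G, Injective (fun q : ι × G => (q.1, ψ q.2)) := by
    intro ψ a b h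
    exact Prod.ext (Prod.mk.inj h).1 (ψ.injective (Prod.mk.inj h).2)
  let Φ := cmp _ (hinj φ)
  let Φ' := cmp _ (hinj φ.symm)
  have hadj : ∀ r, adjoint Φ r = Φ' r := by
    intro r
    refine L2.ext fun ⟨i, x⟩ => ?_
    have := cmp_adj _ (hinj φ) r (i, φ.symm x)
    simp only [MulEquiv.apply_symm_apply] at this
    exact this
  have hΦp : Φ p = p := by
    symm
    refine Submodule.eq_starProjection_of_mem_orthogonal ?_ ?_
    · exact (mem_Rsub hztop _).2 (((mem_Rsub hztop _).1 hpR).aut φ hzφ)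
    · have h1 : dl (j, (1 : G)) = Φ (dl (j, 1)) := by
        have := cmp_dl _ (hinj φ) (j, 1)
        simp only [map_one] at this
        exact this.symm
      rw [h1, ← map_sub, Submodule.mem_orthogonal]
      intro r hr
      rw [← adjoint_inner_left, hadj]
      have h2 : Φ' r ∈ R := (mem_Rsub hztop _).2 (((mem_Rsub hztop _).1 hr).aut φ.symm hzφ')
      exact Submodule.inner_right_of_mem_orthogonal h2 (Submodule.sub_starProjection_mem_orthogonal _)
  have hpφ : ∀ i x, p (i, φ x) = p (i, x) := by
    intro i x
    conv_rhs => rw [← hΦp]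
    rfl
  have hpit : ∀ n i x, p (i, (⇑φ)^[n] x) = p (i, x) := by
    intro n i x
    induction n with
    | zero => rfl
    | succ n ih => rw [iterate_succ_apply', hpφ, ih]
  have hper : ∀ i x, p (i, x) ≠ 0 → ∃ n > 0, (⇑φ)^[n] x = x := by
    intro i x hx
    have h1 := (l2_normsq p).summable.tendsto_cofinite_zero
    have h2 : ∀ᶠ q in Filter.cofinite, p q ^ 2 < p (i, x) ^ 2 :=
      h1.eventually_lt_const (by positivity)
    have h3 : ¬ Injective (fun n : ℕ => ((i, (⇑φ)^[n] x) : ι × G)) := by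
      intro hinj
      have h4 := hinj.tendsto_cofinite.eventually h2
      obtain ⟨n, hn⟩ := h4.exists
      rw [hpit] at hn
      exact lt_irrefl _ hn
    rw [Injective] at h3
    push Not at h3
    obtain ⟨a, b, hab, hne⟩ := h3
    have hab : (⇑φ)^[a] x = (⇑φ)^[b] x := (Prod.mk.inj hab).2
    have gen : ∀ a b : ℕ, a < b → (⇑φ)^[a] x = (⇑φ)^[b] x → ∃ n > 0, (⇑φ)^[n] x = x := by
      intro a b hlt h
      refine ⟨b - a, by omega, ?_⟩
      apply φ.injective.iterate a
      rw [← iterate_add_apply, h]; congr 2; omega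
    rcases lt_or_gt_of_ne hne with h | h
    · exact gen a b h hab
    · exact gen b a h hab.symm
  have hmulit : ∀ n x y, (⇑φ)^[n] (x * y) = (⇑φ)^[n] x * (⇑φ)^[n] y := by
    intro n x y
    induction n with
    | zero => rfl
    | succ n ih => simp only [iterate_succ_apply', ih, map_mul]
  have hinvit : ∀ n x, (⇑φ)^[n] x⁻¹ = ((⇑φ)^[n] x)⁻¹ := by
    intro n x
    induction n with
    | zero => rfl
    | succ n ih => simp only [iterate_succ_apply', ih, map_inv]
  have honeit : ∀ n, (⇑φ)^[n] (1 : G) = 1 := by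
    intro n
    induction n with
    | zero => rfl
    | succ n ih => simp only [iterate_succ_apply', ih, map_one]
  have hmulper : ∀ a b x, (⇑φ)^[a] x = x → (⇑φ)^[a * b] x = x := by
    intro a b x h
    rw [iterate_mul]
    exact iterate_fixed h b
  let Pr : Subgroup G :=
    { carrier := {x | ∃ n > 0, (⇑φ)^[n] x = x}
      one_mem' := ⟨1, one_pos, honeit 1⟩
      mul_mem' := by
        rintro x y ⟨a, ha, hax⟩ ⟨b, hb, hby⟩
        refine ⟨a * b, Nat.mul_pos ha hb, ?_⟩
        rw [hmulit, hmulper a b x hax, mul_comm a b, hmulper b a y hby]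
      inv_mem' := by
        rintro x ⟨a, ha, hax⟩
        exact ⟨a, ha, by rw [hinvit, hax]⟩ }
  have hzPr : ∀ j, z j ∈ Pr := fun j => ⟨1, one_pos, hzφ j⟩
  obtain ⟨κ0, s0, hs0⟩ := exists_FB (⊤ : Subgroup G)
  have hpPr : Rel z Pr p := lemL3 hs0 le_top z hzPr p ((mem_Rsub hztop _).1 hpR) (by
    rintro ⟨i, x⟩ hx
    by_contra h
    exact hx (hper i x h))
  obtain ⟨κ1, b, hb⟩ := exists_FB Pr
  obtain ⟨B, hBfin, hB⟩ := fin_supp' b z (fun j => by rw [hb.closure]; exact hzPr j)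
  have hpB := lemL3'' hb B z hB p hpPr
  have hBper : ∀ k, ∃ n > 0, (⇑φ)^[n] (b k) = b k := fun k => hb.mem k
  choose per hper0 hperb using hBper
  let m := ∏ k ∈ hBfin.toFinset, per k
  have hm0 : 0 < m := Finset.prod_pos fun k _ => hper0 k
  have hmB : ∀ k ∈ B, (⇑φ)^[m] (b k) = b k := by
    intro k hk
    have : per k ∣ m := Finset.dvd_prod_of_mem per (hBfin.mem_toFinset.2 hk)
    obtain ⟨c, hc⟩ := this
    rw [hc]; exact hmulper _ _ _ (hperb k)
  let T : Set G := ⋃ i ∈ Finset.range m, (fun x => (⇑φ)^[i] x) '' (b '' B)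
  have hTfin : T.Finite := (Finset.range m).finite_toSet.biUnion fun i _ => (hBfin.image _).image _
  have hTmem : ∀ i, ∀ k ∈ B, (⇑φ)^[i] (b k) ∈ T := by
    intro i k hk
    refine Set.mem_biUnion (x := i % m) (Finset.mem_coe.2 (Finset.mem_range.2 (Nat.mod_lt _ hm0))) ?_
    refine ⟨b k, ⟨k, hk, rfl⟩, ?_⟩
    exact IsPeriodicPt.iterate_mod_apply (hmB k hk) i
  have hT' : ∀ t ∈ T, ∃ i, ∃ k ∈ B, t = (⇑φ)^[i] (b k) := by
    intro t ht
    simp only [T, Set.mem_iUnion] at ht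
    obtain ⟨i, _, _, ⟨k, hk, rfl⟩, rfl⟩ := ht
    exact ⟨i, k, hk, rfl⟩
  let L := Subgroup.closure T
  have hBL : Subgroup.closure (b '' B) ≤ L := by
    refine Subgroup.closure_mono ?_
    rintro _ ⟨k, hk, rfl⟩
    exact hTmem 0 k hk
  have hpL : Rel z L p := hpB.mono hBL
  have hzL : ∀ j, z j ∈ L := fun j => hBL (hB j)
  have hLφ : ∀ x ∈ L, φ x ∈ L := by
    have : L ≤ L.comap φ.toMonoidHom := by
      rw [Subgroup.closure_le]
      intro t ht
      obtain ⟨i, k, hk, rfl⟩ := hT' t ht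
      refine Subgroup.subset_closure ?_
      have := hTmem (i + 1) k hk
      rw [iterate_succ_apply'] at this
      exact this
    exact this
  have hLm : ∀ x ∈ L, (⇑φ)^[m] x = x := by
    intro x hx
    induction hx using Subgroup.closure_induction with
    | mem t ht =>
      obtain ⟨i, k, hk, rfl⟩ := hT' t ht
      rw [← iterate_add_apply, add_comm, iterate_add_apply, hmB k hk]
    | one => exact honeit m
    | mul x y _ _ hx hy => rw [hmulit, hx, hy]
    | inv x _ hx => rw [hinvit, hx]
  have := propX_core φ H hH hs' e he L hLφ m hm0 hLm hTfin rfl hzL p hpL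
  exact hp0 (L2.ext fun q => congrFun this q)

end propX
end S8

namespace S8
open Function
section top
open ContinuousLinearMap
variable {G : Type*} [Group G]

theorem limit_lem {ι : Type*} [Fintype ι] (y : ι → G) (N : ℕ → Subgroup G) (hN : Antitone N)
    (hy : ∀ i j, y j ∈ N i)
    (h : ∀ i, 1 ≤ ∑ j, ‖(Rsub y (N i)).starProjection (dl (j, (1 : G)))‖ ^ 2) :
    ∃ d : L2 (ι × G), (∀ i, Rel y (N i) d) ∧ (∃ j, d (j, 1) ≠ 0) ∧
      ∀ p : ι × G, p.2 ∉ (⨅ i, N i) → d p = 0 := by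
  classical
  have hanti : Antitone fun i => Rsub y (N i) := by
    intro i k hik d hd
    exact (mem_Rsub (hy i) d).2 (((mem_Rsub (hy k) d).1 hd).mono (hN hik))
  obtain ⟨j, d0, hd0, hne⟩ := hilb_limit (fun j => dl (j, (1 : G))) (fun i => Rsub y (N i)) hanti h
  let R : Submodule ℝ (L2 (ι × G)) := ⨅ i, Rsub y (N i)
  have hRmem : ∀ d, d ∈ R ↔ ∀ i, Rel y (N i) d := by
    intro d
    simp only [R, Submodule.mem_iInf]
    exact forall_congr' fun i => mem_Rsub (hy i) d
  have hcl : IsClosed (R : Set (L2 (ι × G))) := by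
    simp only [R, Submodule.coe_iInf]
    refine isClosed_iInter fun i => ?_
    have := Submodule.isClosed_orthogonal (Rsub y (N i))ᗮ
    rwa [Submodule.orthogonal_orthogonal] at this
  have : CompleteSpace R := hcl.completeSpace_coe
  set p := R.starProjection (dl (j, (1 : G))) with hpdef
  have hpR : p ∈ R := Submodule.starProjection_apply_mem _ _
  have hpin : ∀ r ∈ R, inner ℝ p r = r (j, 1) := by
    intro r hr
    rw [hpdef, Submodule.inner_starProjection_left_eq_right,
      Submodule.starProjection_eq_self_iff.2 hr, inner_dl]
  have hd0R : d0 ∈ R := by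
    simp only [R, Submodule.mem_iInf]; exact hd0
  have hp0 : p ≠ 0 := by
    intro hp
    have h1 := hpin d0 hd0R
    rw [hp, inner_zero_left] at h1
    rw [inner_dl] at hne
    exact hne h1.symm
  refine ⟨p, (hRmem p).1 hpR, ⟨j, ?_⟩, ?_⟩
  · rw [← hpin p hpR]
    exact inner_self_ne_zero.2 hp0
  · rintro q hq
    rw [Subgroup.mem_iInf] at hq
    push Not at hq
    obtain ⟨i, hi⟩ := hq
    let W : Set G := {x | x ∉ N i}
    have hsum : Summable fun q : ι × G => (W.indicator 1 q.2 * p q) ^ 2 := by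
      refine Summable.of_nonneg_of_le (fun _ => sq_nonneg _) (fun q => ?_) (l2_normsq p).summable
      by_cases hq : q.2 ∈ W <;> simp [hq, sq_nonneg]
    let r := mkL _ hsum
    have hr : ∀ q, r q = W.indicator 1 q.2 * p q := fun q => mkL_apply _ _ _
    have hk : ∀ k, i ≤ k → Rel y (N k) r := by
      intro k hik
      have := Rel.ind (hy k) ((hRmem p).1 hpR k) W (by
        intro x n hn hx hxn
        exact hx ((Subgroup.mul_mem_cancel_right _ (hN hik hn)).1 hxn))
      have e : (r : ι × G → ℝ) = fun q => W.indicator 1 q.2 * p q := funext hr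
      rw [e]; exact this
    have hrR : r ∈ R := by
      rw [hRmem]
      intro k
      rcases le_total i k with hik | hik
      · exact hk k hik
      · exact (hk i le_rfl).mono (hN hik)
    have h1 := hpin r hrR
    rw [hr, Set.indicator_of_notMem (by simp [W]), zero_mul, l2_inner] at h1
    have h2 : HasSum (fun q => r q ^ 2) 0 := by
      have h3 : (fun q => r q ^ 2) = fun q => r q * p q := by
        funext q
        rw [hr]
        by_cases hq : q.2 ∈ W <;> simp [hq, sq]
      have := (l2_normsq r).summable.hasSum
      rw [h3] at this ⊢
      rwa [h1] at this
    have h3 := (hasSum_zero_iff_of_nonneg (fun q => sq_nonneg (r q))).1 h2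
    have h4 : r q ^ 2 = 0 := congrFun h3 q
    have hqW : q.2 ∈ W := hi
    rw [hr, Set.indicator_of_mem hqW] at h4
    simpa using h4

theorem core [IsFreeGroup G] (D : ℕ → Subgroup G) (hD : Antitone D)
    (E : Subgroup G) (hE : E = ⨅ i, D i) (φ : E ≃* E) (H : Subgroup G) (hHE : H ≤ E)
    (hH : ∀ x : E, (x : G) ∈ H ↔ φ x = x) (M : Subgroup G) (n : ℕ)
    (hrk : ∀ i, rkLe (D i ⊓ M) n)
    {κ : Type*} {s : κ → G} (hs : FB s (H ⊓ M)) (e : Fin (n+1) → κ) (he : Injective e) : False := by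
  classical
  set Y : Fin (n+1) → G := s ∘ e with hYdef
  have hYHM : ∀ j, Y j ∈ H ⊓ M := fun j => hs.mem _
  have hED : ∀ i, E ≤ D i := fun i => hE ▸ iInf_le D i
  have hYN : ∀ i j, Y j ∈ D i ⊓ M := fun i j => ⟨hED i (hHE (hYHM j).1), (hYHM j).2⟩
  obtain ⟨d, hdR, ⟨j0, hj0⟩, hsupp⟩ := limit_lem Y (fun i => D i ⊓ M)
    (fun i k hik => inf_le_inf_right _ (hD hik)) hYN (by
      intro i
      obtain ⟨S, hS, hSc⟩ := hrk i
      have hr : Subgroup.closure (Set.range (fun x : S => (x : G))) = D i ⊓ M := by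
        rw [← hSc]; congr 1; ext x; simp
      have := rank_bound (fun x : S => (x : G)) Y (by rw [hr]; exact hYN i) (by simpa using hS)
      rwa [hr] at this)
  have hsupp' : ∀ p : Fin (n+1) × G, p.2 ∉ E ⊓ M → d p = 0 := by
    intro p hp
    apply hsupp
    rw [Subgroup.mem_iInf]
    intro h
    apply hp
    refine ⟨?_, (h 0).2⟩
    rw [hE]
    exact Subgroup.mem_iInf.2 fun i => (h i).1
  obtain ⟨κ0, s0, hs0⟩ := exists_FB (D 0 ⊓ M)
  have h1 : Rel Y (E ⊓ M) d := lemL3 hs0 (inf_le_inf_right _ (hED 0)) Y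
    (fun j => ⟨hHE (hYHM j).1, (hYHM j).2⟩) d (hdR 0) hsupp'
  have h2 : Rel Y E d := h1.mono inf_le_left
  obtain ⟨κ1, s1, hs1⟩ := exists_FB (H.subgroupOf E)
  have hcl : Subgroup.closure (Set.range (fun k => (s1 k : G))) = H := by
    have := congrArg (Subgroup.map E.subtype) hs1.closure
    rw [MonoidHom.map_closure, ← Set.range_comp, Subgroup.subgroupOf_map_subtype,
      inf_eq_left.2 hHE] at this
    exact this
  obtain ⟨B, hBfin, hB⟩ := fin_supp' (fun k => (s1 k : G)) Y (by rw [hcl]; exact fun j => (hYHM j).1)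
  have : Fintype B := hBfin.fintype
  let z : B → G := fun k => (s1 k : G)
  have hzr : Set.range z = (fun k => (s1 k : G)) '' B := by
    rw [Set.image_eq_range]
  have hzH : ∀ k, z k ∈ H := fun k => Subgroup.mem_subgroupOf.1 (hs1.mem k)
  have hzE : ∀ k, z k ∈ E := fun k => (s1 k).2
  obtain ⟨O, hOe, hO⟩ := opB z Y (by rw [hzr]; exact hB)
  have h3 : Rel z E (adjoint O d) := (rel_adj O hO hzE d).2 h2
  have h4 : adjoint O d = 0 := by
    refine L2.ext fun ⟨k, x0⟩ => ?_
    have h5 := lemT E E le_rfl z hzE _ h3 x0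
    rw [Subgroup.subgroupOf_self] at h5
    have hinj : Injective (fun p : B × E => ((p.1, x0 * (p.2 : G)) : B × G)) := by
      rintro ⟨a, b⟩ ⟨a', b'⟩ h
      have h' := Prod.mk.inj h
      exact Prod.ext h'.1 (Subtype.ext (mul_left_cancel h'.2))
    have h6 := propX φ (H.subgroupOf E) (fun x => by rw [Subgroup.mem_subgroupOf]; exact hH x) hs1
      (fun k : B => (k : κ1)) Subtype.val_injective (cmp _ hinj (adjoint O d)) h5
    have h7 := cmp_apply _ hinj (adjoint O d) (k, 1)
    rw [h6] at h7
    simp only [Subgroup.coe_one, mul_one] at h7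
    rw [← h7]; rfl
  have h5 : Rel Y H d := by
    rw [← rel_adj O hO hzH d, h4]
    intro u _
    simp [L2.zero_apply]
  have h6 := Rel.ind (fun j => (hYHM j).1) h5 (H : Set G) (fun x m hm hx => H.mul_mem hx hm)
  obtain ⟨κ2, s2, hs2⟩ := exists_FB H
  have h7 := lemL3 hs2 (inf_le_left : H ⊓ M ≤ H) Y hYHM _ h6 (by
    intro p hp
    by_cases hpH : p.2 ∈ (H : Set G)
    · rw [hsupp' p (fun hpE => hp ⟨hpH, hpE.2⟩), mul_zero]
    · rw [Set.indicator_of_notMem hpH, zero_mul])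
  have h8 := congrFun (lemL1 hs e he _ h7) (j0, 1)
  rw [Set.indicator_of_mem (by exact H.one_mem)] at h8
  simp only [Pi.one_apply, one_mul, Pi.zero_apply] at h8
  exact hj0 h8

theorem core' [IsFreeGroup G] (D : ℕ → Subgroup G) (hD : Antitone D)
    (E : Subgroup G) (hE : E = ⨅ i, D i) (φ : E ≃* E) (H : Subgroup G) (hHE : H ≤ E)
    (hH : ∀ x : E, (x : G) ∈ H ↔ φ x = x) (M : Subgroup G) (n : ℕ)
    (hrk : ∀ i, rkLe (D i ⊓ M) n) : rkLe (H ⊓ M) n := by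
  classical
  obtain ⟨κ, s, hs⟩ := exists_FB (H ⊓ M)
  have hno : ∀ e : Fin (n+1) → κ, ¬ Injective e := fun e he =>
    core D hD E hE φ H hHE hH M n hrk hs e he
  have hfin : Finite κ := by
    by_contra h
    rw [not_finite_iff_infinite] at h
    let f := Infinite.natEmbedding κ
    exact hno (fun i => f i) (fun a b h => Fin.ext (f.injective h))
  have := Fintype.ofFinite κ
  have hcard : Fintype.card κ ≤ n := by
    by_contra h
    push Not at h
    have : Fintype.card (Fin (n+1)) ≤ Fintype.card κ := by simpa using h
    obtain ⟨f⟩ := Function.Embedding.nonempty_of_card_le this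
    exact hno f f.injective
  refine ⟨Finset.univ.image s, Finset.card_image_le.trans (by simpa using hcard), ?_⟩
  rw [Finset.coe_image, Finset.coe_univ, Set.image_univ, hs.closure]

theorem rkLe_map {G' : Type*} [Group G'] (f : G →* G') {A : Subgroup G} {n : ℕ} (h : rkLe A n) :
    rkLe (A.map f) n := by
  classical
  obtain ⟨S, hS, rfl⟩ := h
  exact ⟨S.image f, Finset.card_image_le.trans hS, by
    rw [MonoidHom.map_closure, Finset.coe_image]⟩

theorem rkLe_of_map {G' : Type*} [Group G'] (f : G →* G') (hf : Injective f) {A : Subgroup G} {n : ℕ}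
    (h : rkLe (A.map f) n) : rkLe A n := by
  classical
  obtain ⟨S, hS, hSA⟩ := h
  have hsub : (S : Set G') ⊆ Set.range f := by
    intro x hx
    have : x ∈ A.map f := hSA ▸ Subgroup.subset_closure hx
    obtain ⟨a, _, rfl⟩ := this
    exact ⟨a, rfl⟩
  refine ⟨S.preimage f hf.injOn, ?_, ?_⟩
  · refine le_trans ?_ hS
    rw [← Finset.card_image_of_injective _ hf]
    refine Finset.card_le_card fun x hx => ?_
    obtain ⟨a, ha, rfl⟩ := Finset.mem_image.1 hx
    exact Finset.mem_preimage.1 ha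
  · apply Subgroup.map_injective hf
    rw [MonoidHom.map_closure, ← hSA, Finset.coe_preimage, Set.image_preimage_eq_of_subset hsub]

theorem inert_pull {A : Type*} [Group A] (g h : A →* G) (hg : Injective g) (hh : Injective h)
    (J : Subgroup G) (hJ : h.range ≤ J)
    (hing : InertIn g.range J) (D : Subgroup G) (hD : InertIn D J) :
    InertIn ((D.comap h).map g) J := by
  intro K hK n hn
  have h1 := hing K hK n hn
  rw [← Subgroup.map_comap_eq] at h1
  have h2 := rkLe_map h (rkLe_of_map g hg h1)
  have h3 := hD _ ((Subgroup.map_le_range _ _).trans hJ) n h2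
  have h4 : D ⊓ (K.comap g).map h = (D.comap h ⊓ K.comap g).map h := by
    ext x
    constructor
    · rintro ⟨hx, a, ha, rfl⟩
      exact ⟨a, ⟨hx, ha⟩, rfl⟩
    · rintro ⟨a, ⟨ha, ha'⟩, rfl⟩
      exact ⟨ha, a, ha', rfl⟩
  rw [h4] at h3
  have h5 := rkLe_map g (rkLe_of_map h hh h3)
  have h6 : (D.comap h).map g ⊓ K = (D.comap h ⊓ K.comap g).map g := by
    ext x
    constructor
    · rintro ⟨⟨a, ha, rfl⟩, hx⟩
      exact ⟨a, ⟨ha, hx⟩, rfl⟩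
    · rintro ⟨a, ⟨ha, ha'⟩, rfl⟩
      exact ⟨⟨a, ha, rfl⟩, ha'⟩
  rwa [h6]

theorem inert_inf {A B J : Subgroup G} (hA : InertIn A J) (hB : InertIn B J) : InertIn (A ⊓ B) J := by
  intro K hK n hn
  rw [inf_assoc]
  exact hA _ (inf_le_right.trans hK) n (hB K hK n hn)

def DD {A : Type*} [Group A] (g h : A →* G) : ℕ → Subgroup G
  | 0 => g.range ⊔ h.range
  | n+1 => DD g h n ⊓ (((DD g h n).comap h).map g ⊓ ((DD g h n).comap g).map h)

theorem main {A : Type*} [Group A] [IsFreeGroup G] (g h : A →* G)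
    (hg : Injective g) (hh : Injective h)
    (hing : InertIn g.range (g.range ⊔ h.range))
    (hinh : InertIn h.range (g.range ⊔ h.range)) : Inert (g.eqLocus h) := by
  intro K n hK
  have hin : ∀ i, InertIn (DD g h i) (g.range ⊔ h.range) := by
    intro i
    induction i with
    | zero =>
      intro K hK n hn
      change rkLe ((g.range ⊔ h.range) ⊓ K) n
      rwa [inf_eq_right.2 hK]
    | succ i ih =>
      exact inert_inf ih (inert_inf (inert_pull g h hg hh _ le_sup_right hing _ ih)
        (inert_pull h g hh hg _ le_sup_left hinh _ ih))
  have hanti : Antitone (DD g h) := antitone_nat_of_succ_le fun i => inf_le_left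
  let E : Subgroup G := ⨅ i, DD g h i
  have hEmem : ∀ x, x ∈ E ↔ ∀ i, x ∈ DD g h i := fun x => Subgroup.mem_iInf
  have hgh : E.comap g = E.comap h := by
    ext a
    rw [Subgroup.mem_comap, Subgroup.mem_comap, hEmem, hEmem]
    constructor
    · intro H i
      obtain ⟨_, ⟨b, hb, hab⟩, _⟩ := H (i+1)
      rw [← hg hab]; exact hb
    · intro H i
      obtain ⟨_, _, ⟨b, hb, hab⟩⟩ := H (i+1)
      rw [← hh hab]; exact hb
  have hEg : ∀ x ∈ E, ∃ a, g a = x := by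
    intro x hx
    obtain ⟨_, ⟨b, hb, hab⟩, _⟩ := (hEmem x).1 hx 1
    exact ⟨b, hab⟩
  have hEh : ∀ x ∈ E, ∃ a, h a = x := by
    intro x hx
    obtain ⟨_, _, ⟨b, hb, hab⟩⟩ := (hEmem x).1 hx 1
    exact ⟨b, hab⟩
  let B : Subgroup A := E.comap g
  have hBh : ∀ b : B, h b ∈ E := fun b => by
    have h1 : (b : A) ∈ E.comap h := hgh.le b.2
    exact h1
  let g0 : B →* E := (g.comp B.subtype).codRestrict E (fun b => b.2)
  let h0 : B →* E := (h.comp B.subtype).codRestrict E hBh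
  have hg0 : ∀ b, (g0 b : G) = g b := fun _ => rfl
  have hh0 : ∀ b, (h0 b : G) = h b := fun _ => rfl
  have bg : Bijective g0 := by
    constructor
    · intro a b hab
      exact Subtype.ext (hg (congrArg Subtype.val hab))
    · rintro ⟨x, hx⟩
      obtain ⟨a, rfl⟩ := hEg x hx
      exact ⟨⟨a, hx⟩, rfl⟩
  have bh : Bijective h0 := by
    constructor
    · intro a b hab
      exact Subtype.ext (hh (congrArg Subtype.val hab))
    · rintro ⟨x, hx⟩
      obtain ⟨a, rfl⟩ := hEh x hx
      have : a ∈ B := hgh.ge hx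
      exact ⟨⟨a, this⟩, rfl⟩
  let φ : E ≃* E := (MulEquiv.ofBijective g0 bg).symm.trans (MulEquiv.ofBijective h0 bh)
  have hφ : ∀ b, φ (g0 b) = h0 b := by
    intro b
    change MulEquiv.ofBijective h0 bh ((MulEquiv.ofBijective g0 bg).symm
      ((MulEquiv.ofBijective g0 bg) b)) = h0 b
    rw [MulEquiv.symm_apply_apply]; rfl
  have hHE : (g.eqLocus h).map g ≤ E := by
    rintro _ ⟨a, ha, rfl⟩
    have ha' : g a = h a := ha
    rw [hEmem]
    intro i
    induction i with
    | zero => exact (le_sup_left : g.range ≤ g.range ⊔ h.range) ⟨a, rfl⟩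
    | succ i ih =>
      refine ⟨ih, ⟨a, ?_, rfl⟩, ⟨a, ih, ha'.symm⟩⟩
      change h a ∈ DD g h i
      rwa [← ha']
  have hfix : ∀ x : E, (x : G) ∈ (g.eqLocus h).map g ↔ φ x = x := by
    intro x
    obtain ⟨b, rfl⟩ := bg.2 x
    rw [hφ, Subtype.ext_iff, hg0, hh0]
    constructor
    · rintro ⟨a, ha, hab⟩
      rw [← hg hab]
      exact (show g a = h a from ha).symm
    · intro H
      exact ⟨b, H.symm, rfl⟩
  have := core' (DD g h) hanti E rfl φ _ hHE hfix (K.map g) n (fun i =>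
    hin i _ ((Subgroup.map_le_range _ _).trans le_sup_left) n (rkLe_map g hK))
  rw [← Subgroup.map_inf _ _ _ hg] at this
  exact rkLe_of_map g hg this

end top
end S8

/-- if `g, h` are injective and both `im g` and `im h` are inert in
`⟨im g ∪ im h⟩`, then `Eq(g,h)` is inert in `F(Σ)`. -/
theorem stmt_8 {α β : Type} (g h : FreeGroup α →* FreeGroup β)
    (hg : Function.Injective g) (hh : Function.Injective h)
    (hing : InertIn g.range (g.range ⊔ h.range))
    (hinh : InertIn h.range (g.range ⊔ h.range)) :
    Inert (g.eqLocus h) := by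
  exact S8.main g h hg hh hing hinh
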